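/- Let H be a separable infinite-dimensional real Hilbert space. Then the space J(H) = {J a bounded operator on H : J* = −J and J² = −1} of orthogonal complex structures on H, equipped with the operator-norm topology, is contractible. -/

import Mathlib

open Filter Topology

section InvSqrt

variable {A : Type*} [NormedRing A] [NormedAlgebra ℝ A]

/-- The binomial series of `(1 + z) ^ (-1/2)`. -/
noncomputable def invSqrtSeries (z : A) : A := ∑' n : ℕ, Ring.choose (-1 / 2 : ℝ) n • z ^ n

theorem norm_pow_le_one_add_norm_one_mul {A : Type*} [NormedRing A] (z : A) (n : ℕ) :
    ‖z ^ n‖ ≤ (1 + ‖(1 : A)‖) * ‖z‖ ^ n := by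
  rcases Nat.eq_zero_or_pos n with rfl | hn
  · simp
  · calc ‖z ^ n‖ ≤ 1 * ‖z‖ ^ n := by simpa using norm_pow_le' z hn
      _ ≤ _ := by gcongr; simp

theorem summable_abs_choose_mul_pow {ρ : ℝ} (h0 : 0 ≤ ρ) (h1 : ρ < 1) :
    Summable fun n : ℕ => |Ring.choose (-1 / 2 : ℝ) n| * ρ ^ n := by
  lift ρ to NNReal using h0
  have := (binomialSeries ℝ (-1 / 2 : ℝ)).summable_norm_mul_pow (r := ρ)
    (lt_of_lt_of_le (ENNReal.coe_lt_one_iff.2 h1) binomialSeries_radius_ge_one)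
  simpa only [binomialSeries, FormalMultilinearSeries.ofScalars_norm, Real.norm_eq_abs] using this

theorem norm_choose_smul_pow_le {z : A} {ρ : ℝ} (hz : ‖z‖ ≤ ρ) (n : ℕ) :
    ‖Ring.choose (-1 / 2 : ℝ) n • z ^ n‖ ≤
      (1 + ‖(1 : A)‖) * (|Ring.choose (-1 / 2 : ℝ) n| * ρ ^ n) := by
  rw [norm_smul, Real.norm_eq_abs, mul_left_comm]
  gcongr
  exact (norm_pow_le_one_add_norm_one_mul z n).trans (by gcongr)

theorem summable_norm_choose_smul_pow {z : A} (hz : ‖z‖ < 1) :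
    Summable fun n : ℕ => ‖Ring.choose (-1 / 2 : ℝ) n • z ^ n‖ :=
  .of_nonneg_of_le (fun _ => norm_nonneg _) (norm_choose_smul_pow_le le_rfl)
    ((summable_abs_choose_mul_pow (norm_nonneg z) hz).mul_left _)

theorem star_invSqrtSeries [StarRing A] [ContinuousStar A] [StarModule ℝ A] (z : A) :
    star (invSqrtSeries z) = invSqrtSeries (star z) := by
  simp [invSqrtSeries, tsum_star]

variable [CompleteSpace A]

theorem continuousOn_invSqrtSeries : ContinuousOn (invSqrtSeries (A := A)) {z | ‖z‖ < 1} := by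
  intro z hz
  obtain ⟨ρ, hzρ, hρ⟩ := exists_between (show ‖z‖ < 1 from hz)
  have hc : ContinuousOn (invSqrtSeries (A := A)) {z | ‖z‖ < ρ} :=
    continuousOn_tsum (fun n => by fun_prop)
      ((summable_abs_choose_mul_pow ((norm_nonneg z).trans hzρ.le) hρ).mul_left _)
      (fun n x hx => norm_choose_smul_pow_le (le_of_lt hx) n)
  exact (hc.continuousAt
    ((isOpen_lt continuous_norm continuous_const).mem_nhds hzρ)).continuousWithinAt

theorem sum_antidiagonal_choose_mul_choose (n : ℕ) :
    ∑ kl ∈ Finset.HasAntidiagonal.antidiagonal n,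
      Ring.choose (-1 / 2 : ℝ) kl.1 * Ring.choose (-1 / 2 : ℝ) kl.2 = (-1) ^ n := by
  rw [← Ring.add_choose_eq n (Commute.all _ _)]
  norm_num
  rw [Ring.choose_neg]
  have : (1 : ℝ) + n - 1 = (n : ℕ) := by ring
  rw [this, Ring.choose_natCast]
  simp [Units.smul_def]

theorem invSqrtSeries_mul_self {z : A} (hz : ‖z‖ < 1) :
    (1 + z) * (invSqrtSeries z * invSqrtSeries z) = 1 := by
  have h : invSqrtSeries z * invSqrtSeries z = ∑' n : ℕ, (-z) ^ n := by
    rw [invSqrtSeries, tsum_mul_tsum_eq_tsum_sum_antidiagonal_of_summable_norm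
      (summable_norm_choose_smul_pow hz) (summable_norm_choose_smul_pow hz)]
    refine tsum_congr fun n => ?_
    rw [neg_pow, show (-1 : A) ^ n * z ^ n = (-1 : ℝ) ^ n • z ^ n by
      rcases Nat.even_or_odd n with h | h <;> simp [h.neg_one_pow],
      ← sum_antidiagonal_choose_mul_choose n, Finset.sum_smul]
    refine Finset.sum_congr rfl fun kl hkl => ?_
    rw [smul_mul_smul_comm, ← pow_add, Finset.HasAntidiagonal.mem_antidiagonal.1 hkl]
  rw [h]
  simpa using mul_neg_geom_series (-z) (by simpa using hz)

theorem Commute.invSqrtSeries_right {a z : A} (hz : ‖z‖ < 1) (h : Commute a z) :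
    Commute a (invSqrtSeries z) := by
  have hs := (summable_norm_choose_smul_pow hz).of_norm
  rw [Commute, SemiconjBy, invSqrtSeries, ← hs.tsum_mul_left, ← hs.tsum_mul_right]
  exact tsum_congr fun n => by
    rw [mul_smul_comm, smul_mul_assoc, (h.pow_right n).eq]

theorem mul_invSqrtSeries_of_mul_eq_zero {a z : A} (hz : ‖z‖ < 1) (h : a * z = 0) :
    a * invSqrtSeries z = a := by
  have hs := (summable_norm_choose_smul_pow hz).of_norm
  rw [invSqrtSeries, ← hs.tsum_mul_left, tsum_eq_single 0]
  · simp
  · intro n hn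
    obtain ⟨k, rfl⟩ := Nat.exists_eq_succ_of_ne_zero hn
    rw [mul_smul_comm, pow_succ', ← mul_assoc, h, zero_mul, smul_zero]

theorem invSqrtSeries_zero : invSqrtSeries (0 : A) = 1 := by
  simpa using mul_invSqrtSeries_of_mul_eq_zero (a := 1) (z := (0 : A)) (by simp) (by simp)

theorem mul_invSqrtSeries_mul_self {s : A} (h : ‖1 + s * s‖ < 1) :
    (s * invSqrtSeries (-(1 + s * s))) * (s * invSqrtSeries (-(1 + s * s))) = -1 := by
  have hc : Commute s (invSqrtSeries (-(1 + s * s))) :=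
    Commute.invSqrtSeries_right (by rwa [norm_neg])
      (((Commute.one_right s).add_right ((Commute.refl s).mul_right (Commute.refl s))).neg_right)
  have := invSqrtSeries_mul_self (z := -(1 + s * s)) (by rwa [norm_neg])
  set g := invSqrtSeries (-(1 + s * s))
  calc s * g * (s * g) = s * (g * s) * g := by noncomm_ring
    _ = -((1 + -(1 + s * s)) * (g * g)) := by rw [← hc.eq]; noncomm_ring
    _ = -1 := by rw [this]

end InvSqrt

section ComplexStructure

variable (A : Type*) [NormedRing A] [StarRing A]

/-- The orthogonal complex structures of a normed star ring: skew-adjoint square roots of `-1`. -/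
abbrev OrthComplexStructure : Type _ := {J : A // star J = -J ∧ J * J = -1}

variable {A}
variable [NormedAlgebra ℝ A]

/-- The skew-adjoint part of an element of a real star algebra. -/
noncomputable def skewPart (a : A) : A := (1 / 2 : ℝ) • (a - star a)

theorem skewPart_of_star_eq_neg {a : A} (h : star a = -a) : skewPart a = a := by
  rw [skewPart, h, sub_neg_eq_add, ← two_smul ℝ a, smul_smul]; norm_num

theorem continuous_skewPart [ContinuousStar A] : Continuous (skewPart (A := A)) := by
  unfold skewPart; fun_prop

variable [StarModule ℝ A]

theorem star_skewPart (a : A) : star (skewPart a) = -skewPart a := by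
  simp [skewPart, ← smul_neg]

variable [CompleteSpace A] [ContinuousStar A]

theorem star_mul_invSqrtSeries {s : A} (hs : star s = -s) (h : ‖1 + s * s‖ < 1) :
    star (s * invSqrtSeries (-(1 + s * s))) = -(s * invSqrtSeries (-(1 + s * s))) := by
  have hc : Commute s (invSqrtSeries (-(1 + s * s))) :=
    Commute.invSqrtSeries_right (by rwa [norm_neg])
      (((Commute.one_right s).add_right ((Commute.refl s).mul_right (Commute.refl s))).neg_right)
  have hz : star (-(1 + s * s)) = -(1 + s * s) := by simp [hs]
  rw [star_mul, star_invSqrtSeries, hz, hs, mul_neg, hc.eq]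

open Classical in
/-- The polar retraction onto the orthogonal complex structures, sending `a` with skew-adjoint part
`s` to `s * (-s²) ^ (-1/2)`; it takes the value `J₀` where the binomial series need not converge. -/
noncomputable def polarRetraction (J₀ : OrthComplexStructure A) (a : A) : OrthComplexStructure A :=
  if h : ‖1 + skewPart a * skewPart a‖ < 1 then
    ⟨skewPart a * invSqrtSeries (-(1 + skewPart a * skewPart a)),
      star_mul_invSqrtSeries (star_skewPart a) h, mul_invSqrtSeries_mul_self h⟩
  else J₀

theorem polarRetraction_coe (J₀ J : OrthComplexStructure A) : polarRetraction J₀ (J : A) = J := by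
  have h : ‖1 + (J : A) * J‖ < 1 := by simp [J.2.2]
  ext
  simp only [polarRetraction, skewPart_of_star_eq_neg J.2.1, h, dif_pos]
  simp [J.2.2, invSqrtSeries_zero]

theorem coe_polarRetraction (J₀ : OrthComplexStructure A) {a : A} (ha : star a = -a)
    (h : ‖1 + a * a‖ < 1) : (polarRetraction J₀ a : A) = a * invSqrtSeries (-(1 + a * a)) := by
  simp [polarRetraction, skewPart_of_star_eq_neg ha, h]

theorem continuousOn_polarRetraction (J₀ : OrthComplexStructure A) :
    ContinuousOn (polarRetraction J₀) {a | ‖1 + skewPart a * skewPart a‖ < 1} := by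
  rw [IsEmbedding.subtypeVal.continuousOn_iff]
  have hs := continuous_skewPart (A := A)
  refine ContinuousOn.congr (f := fun a => skewPart a *
    invSqrtSeries (-(1 + skewPart a * skewPart a))) ?_ fun a ha => ?_
  · refine hs.continuousOn.mul (continuousOn_invSqrtSeries.comp (by fun_prop) fun a ha => ?_)
    change ‖-_‖ < 1
    rw [norm_neg]
    exact ha
  · have ha' : ‖1 + skewPart a * skewPart a‖ < 1 := ha
    simp [polarRetraction, ha']

end ComplexStructure

section Straightening

open ContinuousMap

variable {A : Type*} [NormedRing A]

section CStar

variable [StarRing A] [CStarRing A]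

theorem norm_le_one_of_star_mul_self_eq_self {e : A} (h : star e * e = e) :
    ‖e‖ ≤ 1 := by
  have h' := CStarRing.norm_star_mul_self (x := e)
  rw [h] at h'
  nlinarith [norm_nonneg e]

theorem norm_le_one_of_norm_star_mul_self_le {a : A} (h : ‖star a * a‖ ≤ 1) :
    ‖a‖ ≤ 1 := by
  rw [CStarRing.norm_star_mul_self] at h
  nlinarith [norm_nonneg a]

theorem OrthComplexStructure.norm_le_one (J : OrthComplexStructure A) :
    ‖(J : A)‖ ≤ 1 := by
  refine norm_le_one_of_norm_star_mul_self_le ?_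
  rw [J.2.1, neg_mul, J.2.2, neg_neg]
  exact norm_le_one_of_star_mul_self_eq_self (by simp)

end CStar

/-- The block-diagonal part of `rotatedStructure P j 0 1 J`, with the block on `P` replaced
by `j`. -/
def splitStructure (P j J : A) : A := j + (1 - P) * (J + J * j * J) * (1 - P)

theorem star_splitStructure [StarRing A] {P j J : A} (sP : star P = P) (sj : star j = -j)
    (sJ : star J = -J) : star (splitStructure P j J) = -splitStructure P j J := by
  simp only [splitStructure, star_add, star_sub, star_mul, star_one, sP, sj, sJ]
  noncomm_ring

theorem mul_splitStructure {P j J : A} (hP : P * P = P) (hPj : P * j = j) :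
    P * splitStructure P j J = j := by
  have : P * (1 - P) = 0 := by rw [mul_sub, mul_one, hP, sub_self]
  rw [splitStructure, mul_add, hPj, ← mul_assoc, ← mul_assoc, this]
  simp

theorem splitStructure_mul {P j J : A} (hP : P * P = P) (hjP : j * P = j) :
    splitStructure P j J * P = j := by
  have : (1 - P) * P = 0 := by rw [sub_mul, one_mul, hP, sub_self]
  rw [splitStructure, add_mul, hjP, mul_assoc, this]
  simp

variable [NormedAlgebra ℝ A]

/-- For `c = cos θ`, `s = sin θ` and `P J P = 0`, this is the complex structure obtained from `J`
by rotating its restriction to the span of the ranges of `P` and `J P` towards `j - J j J⁻¹`. -/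
def rotatedStructure (P j : A) (c s : ℝ) (J : A) : A :=
  J - (1 - c) • (J * P + P * J) + s • (j + J * j * J)

theorem one_add_rotatedStructure_mul_self {P j J : A} {c s : ℝ} (hP : P * P = P) (hj : j * j = -P)
    (hPj : P * j = j) (hjP : j * P = j) (hJ : J * J = -1) (hcs : c ^ 2 + s ^ 2 = 1) :
    1 + rotatedStructure P j c s J * rotatedStructure P j c s J =
      (1 - c) ^ 2 • (J * (P * J * P) + (P * J * P) * J)
      + s ^ 2 • (j * (P * J * P) * j * J + J * j * (P * J * P) * j)
      - ((1 - c) * s) • ((P * J * P) * j + j * (P * J * P) + J * (P * J * P) * j * J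
        + J * j * (P * J * P) * J) := by
  have hP' : ∀ x, P * (P * x) = P * x := fun x => by rw [← mul_assoc, hP]
  have hj' : ∀ x, j * (j * x) = -(P * x) := fun x => by rw [← mul_assoc, hj, neg_mul]
  have hPj' : ∀ x, P * (j * x) = j * x := fun x => by rw [← mul_assoc, hPj]
  have hjP' : ∀ x, j * (P * x) = j * x := fun x => by rw [← mul_assoc, hjP]
  have hJ' : ∀ x, J * (J * x) = -x := fun x => by rw [← mul_assoc, hJ, neg_mul, one_mul]
  simp only [rotatedStructure, mul_add, add_mul, mul_sub, sub_mul, smul_mul_assoc, mul_smul_comm,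
    smul_add, smul_sub, mul_assoc, hP, hP', hj, hj', hPj, hPj', hjP, hjP', hJ, hJ', mul_neg,
    mul_one, smul_neg, smul_smul, neg_neg]
  match_scalars <;> first
    | linear_combination hcs
    | linear_combination -hcs
    | linear_combination (0 : ℝ) * hcs

theorem norm_one_add_rotatedStructure_mul_self_le {P j J : A} {c s ε : ℝ} (hP : P * P = P)
    (hj : j * j = -P) (hPj : P * j = j) (hjP : j * P = j) (hJ : J * J = -1)
    (hcs : c ^ 2 + s ^ 2 = 1) (hc : 0 ≤ c) (hs : 0 ≤ s) (nj : ‖j‖ ≤ 1) (nJ : ‖J‖ ≤ 1)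
    (hε : ‖P * J * P‖ ≤ ε) :
    ‖1 + rotatedStructure P j c s J * rotatedStructure P j c s J‖ ≤ 8 * ε := by
  rw [one_add_rotatedStructure_mul_self hP hj hPj hjP hJ hcs]
  set q := P * J * P
  have hl : ∀ {x y : A}, ‖x‖ ≤ 1 → ‖y‖ ≤ ε → ‖x * y‖ ≤ ε := fun {x y} hx hy =>
    (norm_mul_le _ _).trans (by nlinarith [norm_nonneg x, norm_nonneg y])
  have hr : ∀ {x y : A}, ‖x‖ ≤ ε → ‖y‖ ≤ 1 → ‖x * y‖ ≤ ε := fun {x y} hx hy =>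
    (norm_mul_le _ _).trans (by nlinarith [norm_nonneg x, norm_nonneg y])
  have h1 : ‖J * j‖ ≤ 1 := (norm_mul_le _ _).trans (mul_le_one₀ nJ (norm_nonneg _) nj)
  have hc1 : c ≤ 1 := by nlinarith
  have hs1 : s ≤ 1 := by nlinarith
  have hε0 : 0 ≤ ε := (norm_nonneg _).trans hε
  have hsm : ∀ {t k : ℝ} {x : A}, 0 ≤ t → t ≤ 1 → ‖x‖ ≤ k → ‖t • x‖ ≤ k := by
    intro t k x h0 h1 hx
    rw [norm_smul, Real.norm_of_nonneg h0]
    nlinarith [norm_nonneg x]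
  have e1 : ‖(1 - c) ^ 2 • (J * q + q * J)‖ ≤ 2 * ε :=
    hsm (sq_nonneg _) (by nlinarith)
      ((norm_add_le _ _).trans (by linarith [hl nJ hε, hr hε nJ]))
  have e2 : ‖s ^ 2 • (j * q * j * J + J * j * q * j)‖ ≤ 2 * ε :=
    hsm (sq_nonneg _) (by nlinarith)
      ((norm_add_le _ _).trans (by linarith [hr (hr (hl nj hε) nj) nJ, hr (hl h1 hε) nj]))
  have e3 : ‖((1 - c) * s) • (q * j + j * q + J * q * j * J + J * j * q * J)‖ ≤ 4 * ε :=
    hsm (by nlinarith) (by nlinarith) (norm_add₄_le.trans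
      (by linarith [hr hε nj, hl nj hε, hr (hr (hl nJ hε) nj) nJ, hr (hl h1 hε) nJ]))
  linarith [norm_sub_le ((1 - c) ^ 2 • (J * q + q * J) + s ^ 2 • (j * q * j * J + J * j * q * j))
    (((1 - c) * s) • (q * j + j * q + J * q * j * J + J * j * q * J)),
    norm_add_le ((1 - c) ^ 2 • (J * q + q * J)) (s ^ 2 • (j * q * j * J + J * j * q * j))]

theorem rotatedStructure_sub_splitStructure {P j J : A} (hPj : P * j = j) (hjP : j * P = j) :
    rotatedStructure P j 0 1 J - splitStructure P j J =
      -(P * J * P) + (P * J * P) * j * (P * J * P) + (1 - P) * (J * j * (P * J * P))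
        + (P * J * P) * j * J * (1 - P) := by
  have hjP' : ∀ x, j * (P * x) = j * x := fun x => by rw [← mul_assoc, hjP]
  simp only [rotatedStructure, splitStructure, mul_add, add_mul, mul_sub, sub_mul, sub_zero,
    one_smul, mul_assoc, hPj, hjP', mul_one, one_mul]
  abel

theorem norm_one_add_segment_mul_self_le {a b : A} {t k : ℝ} (h0 : 0 ≤ t) (h1 : t ≤ 1)
    (hab : ‖a - b‖ ≤ k) :
    ‖1 + (a - t • (a - b)) * (a - t • (a - b))‖ ≤ ‖1 + a * a‖ + 2 * ‖a‖ * k + k ^ 2 := by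
  have hk : 0 ≤ k := (norm_nonneg _).trans hab
  set d := t • (a - b) with hd
  have nd : ‖d‖ ≤ k := by
    rw [hd, norm_smul, Real.norm_of_nonneg h0]; nlinarith [norm_nonneg (a - b)]
  have : 1 + (a - d) * (a - d) = (1 + a * a) - a * d - d * a + d * d := by noncomm_ring
  rw [this]
  have n1 := norm_add_le ((1 + a * a) - a * d - d * a) (d * d)
  have n2 := norm_sub_le ((1 + a * a) - a * d) (d * a)
  have n3 := norm_sub_le (1 + a * a) (a * d)
  nlinarith [norm_mul_le a d, norm_mul_le d a, norm_mul_le d d, norm_nonneg a, norm_nonneg d,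
    mul_le_mul_of_nonneg_left nd (norm_nonneg a), mul_le_mul nd nd (norm_nonneg d) hk]

theorem star_rotatedStructure [StarRing A] [StarModule ℝ A] {P j J : A} (c s : ℝ) (sP : star P = P)
    (sj : star j = -j) (sJ : star J = -J) :
    star (rotatedStructure P j c s J) = -rotatedStructure P j c s J := by
  simp only [rotatedStructure, star_add, star_sub, star_mul, star_smul, sP, sj, sJ, star_trivial,
    mul_neg, neg_mul, neg_neg, mul_assoc]
  module

variable [StarRing A] [StarModule ℝ A] [CompleteSpace A] [CStarRing A]

theorem homotopic_of_polarRetraction_comp {Z : Type*} [TopologicalSpace Z]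
    (J₀ : OrthComplexStructure A) {F : unitInterval × Z → A} (hF : Continuous F)
    (hs : ∀ p, star (F p) = -F p) (h : ∀ p, ‖1 + F p * F p‖ < 1)
    {f g : C(Z, OrthComplexStructure A)} (hf : ∀ z, polarRetraction J₀ (F (0, z)) = f z)
    (hg : ∀ z, polarRetraction J₀ (F (1, z)) = g z) : f.Homotopic g :=
  ⟨{ toFun := fun p => polarRetraction J₀ (F p)
     continuous_toFun := (continuousOn_polarRetraction J₀).comp_continuous hF fun p => by
       simpa [skewPart_of_star_eq_neg (hs p)] using h p
     map_zero_left := hf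
     map_one_left := hg }⟩

/-- A family of complex structures that almost vanish on the corner of a projection `P` can be
deformed to complex structures that commute with `P` and restrict to `j` there. -/
theorem exists_homotopic_mul_eq (J₀ : OrthComplexStructure A) {P j : A} (sP : star P = P)
    (hP : P * P = P) (sj : star j = -j) (hj : j * j = -P) (hPj : P * j = j) (hjP : j * P = j)
    {Z : Type*} [TopologicalSpace Z] (f : C(Z, OrthComplexStructure A))
    (hf : ∀ z, ‖P * (f z : A) * P‖ ≤ 1 / 100) :
    ∃ g : C(Z, OrthComplexStructure A), f.Homotopic g ∧
      ∀ z, (g z : A) * P = j ∧ P * (g z : A) = j := by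
  have nP : ‖P‖ ≤ 1 := norm_le_one_of_star_mul_self_eq_self (by rw [sP, hP])
  have nj : ‖j‖ ≤ 1 := norm_le_one_of_norm_star_mul_self_le (by rwa [sj, neg_mul, hj, neg_neg])
  have nQ : ‖1 - P‖ ≤ 1 := norm_le_one_of_star_mul_self_eq_self (by
    simp only [star_sub, star_one, sP, mul_sub, sub_mul, mul_one, one_mul, hP]; simp)
  have nJ : ∀ z, ‖(f z : A)‖ ≤ 1 := fun z => (f z).norm_le_one
  have hfc : Continuous fun z => (f z : A) := continuous_subtype_val.comp f.continuous
  have hrot : ∀ (z : Z) {c s : ℝ}, c ^ 2 + s ^ 2 = 1 → 0 ≤ c → 0 ≤ s →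
      ‖1 + rotatedStructure P j c s (f z : A) * rotatedStructure P j c s (f z : A)‖ ≤
        8 * (1 / 100) := fun z c s hcs hc hs =>
    norm_one_add_rotatedStructure_mul_self_le hP hj hPj hjP (f z).2.2 hcs hc hs nj (nJ z) (hf z)
  have hdiff : ∀ z, ‖rotatedStructure P j 0 1 (f z : A) - splitStructure P j (f z : A)‖ ≤
      4 / 100 := by
    intro z
    rw [rotatedStructure_sub_splitStructure hPj hjP]
    have hq := hf z
    set q := P * (f z : A) * P
    have hl : ∀ {x y : A}, ‖x‖ ≤ 1 → ‖y‖ ≤ 1 / 100 → ‖x * y‖ ≤ 1 / 100 := fun {x y} hx hy =>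
      (norm_mul_le _ _).trans (by nlinarith [norm_nonneg x, norm_nonneg y])
    have hr : ∀ {x y : A}, ‖x‖ ≤ 1 / 100 → ‖y‖ ≤ 1 → ‖x * y‖ ≤ 1 / 100 := fun {x y} hx hy =>
      (norm_mul_le _ _).trans (by nlinarith [norm_nonneg x, norm_nonneg y])
    have h1 : ‖(f z : A) * j‖ ≤ 1 :=
      (norm_mul_le _ _).trans (mul_le_one₀ (nJ z) (norm_nonneg _) nj)
    refine norm_add₄_le.trans ?_
    rw [norm_neg]
    linarith [hr (hr hq nj) (hq.trans (by norm_num)), hl nQ (hl h1 hq),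
      hr (hr (hr hq nj) (nJ z)) nQ]
  have hnorm : ∀ z, ‖rotatedStructure P j 0 1 (f z : A)‖ ≤ 5 := by
    intro z
    have hm : ∀ {x y : A}, ‖x‖ ≤ 1 → ‖y‖ ≤ 1 → ‖x * y‖ ≤ 1 := fun {x y} hx hy =>
      (norm_mul_le _ _).trans (mul_le_one₀ hx (norm_nonneg _) hy)
    simp only [rotatedStructure, sub_zero, one_smul]
    linarith [norm_add_le ((f z : A) - ((f z : A) * P + P * (f z : A))) (j + (f z : A) * j * f z),
      norm_sub_le (f z : A) ((f z : A) * P + P * (f z : A)), norm_add_le j ((f z : A) * j * f z),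
      norm_add_le ((f z : A) * P) (P * (f z : A)), hm (nJ z) nP, hm nP (nJ z),
      hm (hm (nJ z) nj) (nJ z), nJ z]
  let rotF : unitInterval × Z → A := fun p => rotatedStructure P j
    (Real.cos (p.1 * (Real.pi / 2))) (Real.sin (p.1 * (Real.pi / 2))) (f p.2)
  let segF : unitInterval × Z → A := fun p => rotatedStructure P j 0 1 (f p.2) -
    (p.1 : ℝ) • (rotatedStructure P j 0 1 (f p.2) - splitStructure P j (f p.2))
  have hfc2 : Continuous fun p : unitInterval × Z => (f p.2 : A) := hfc.comp continuous_snd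
  have rotc : Continuous rotF := by
    simp only [rotF, rotatedStructure]; fun_prop
  have segc : Continuous segF := by
    simp only [segF, rotatedStructure, splitStructure]; fun_prop
  have rots : ∀ p, star (rotF p) = -rotF p := fun p =>
    star_rotatedStructure _ _ sP sj (f p.2).2.1
  have segs : ∀ p, star (segF p) = -segF p := fun p => by
    simp only [segF, star_sub, star_smul, star_trivial,
      star_rotatedStructure 0 1 sP sj (f p.2).2.1, star_splitStructure sP sj (f p.2).2.1]
    module
  have rotn : ∀ p, ‖1 + rotF p * rotF p‖ < 1 := fun p => by
    have h0 : 0 ≤ (p.1 : ℝ) * (Real.pi / 2) := mul_nonneg p.1.2.1 (by positivity)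
    have h1 : (p.1 : ℝ) * (Real.pi / 2) ≤ Real.pi / 2 := by
      nlinarith [p.1.2.2, Real.pi_pos]
    refine (hrot p.2 (Real.cos_sq_add_sin_sq _) (Real.cos_nonneg_of_mem_Icc ⟨by linarith, h1⟩)
      (Real.sin_nonneg_of_mem_Icc ⟨h0, by linarith [Real.pi_pos]⟩)).trans_lt (by norm_num)
  have segn : ∀ p, ‖1 + segF p * segF p‖ < 1 := fun p => by
    have := norm_one_add_segment_mul_self_le p.1.2.1 p.1.2.2 (hdiff p.2)
    have h8 := hrot p.2 (c := 0) (s := 1) (by norm_num) le_rfl zero_le_one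
    exact this.trans_lt (by nlinarith [hnorm p.2])
  have endc : ∀ {F : unitInterval × Z → A} (t : unitInterval), Continuous F →
      (∀ p, star (F p) = -F p) → (∀ p, ‖1 + F p * F p‖ < 1) →
      Continuous fun z => polarRetraction J₀ (F (t, z)) := fun {F} t hF hs h =>
    (continuousOn_polarRetraction J₀).comp_continuous (f := fun z => F (t, z)) (by fun_prop)
      fun z => by simpa [skewPart_of_star_eq_neg (hs (t, z))] using h (t, z)
  let g₀ : C(Z, OrthComplexStructure A) := ⟨_, endc 1 rotc rots rotn⟩
  let g₁ : C(Z, OrthComplexStructure A) := ⟨_, endc 1 segc segs segn⟩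
  refine ⟨g₁, ?_, fun z => ?_⟩
  · refine Homotopic.trans (g := g₀)
      (homotopic_of_polarRetraction_comp J₀ rotc rots rotn (fun z => ?_) fun z => rfl)
      (homotopic_of_polarRetraction_comp J₀ segc segs segn (fun z => ?_) fun z => rfl)
    · simpa [rotF, rotatedStructure] using polarRetraction_coe J₀ (f z)
    · simp [segF, rotF, g₀]
  · have hg : (g₁ z : A) = segF (1, z) * invSqrtSeries (-(1 + segF (1, z) * segF (1, z))) :=
      coe_polarRetraction J₀ (segs (1, z)) (segn (1, z))
    have hseg : segF (1, z) = splitStructure P j (f z) := by simp [segF]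
    have hn := segn (1, z)
    rw [hseg] at hg hn
    set B := splitStructure P j (f z)
    have hPB : P * B = j := mul_splitStructure hP hPj
    have hBP : B * P = j := splitStructure_mul hP hjP
    have hz : P * -(1 + B * B) = 0 := by
      rw [mul_neg, mul_add, ← mul_assoc, hPB, ← hjP, mul_assoc, hPB, hj]; simp
    have hcomm : Commute P (invSqrtSeries (-(1 + B * B))) := by
      refine Commute.invSqrtSeries_right (by rwa [norm_neg]) ?_
      have : Commute P B := hPB.trans hBP.symm
      exact ((Commute.one_right P).add_right (this.mul_right this)).neg_right
    have hPg := mul_invSqrtSeries_of_mul_eq_zero (by rwa [norm_neg]) hz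
    rw [hg]
    constructor
    · rw [mul_assoc, ← hcomm.eq, hPg, hBP]
    · rw [← mul_assoc, hPB, ← hjP, mul_assoc, hPg]

end Straightening

section Swindle

open ContinuousMap ContinuousLinearMap

section Anticommuting

variable {A : Type*} [NormedRing A] [NormedAlgebra ℝ A]

theorem cos_smul_add_sin_smul_mul_self {P K L : A} (θ : ℝ) (hK : K * K = -P) (hL : L * L = -P)
    (h : K * L = -(L * K)) :
    (Real.cos θ • K + Real.sin θ • L) * (Real.cos θ • K + Real.sin θ • L) = -P := by
  simp only [mul_add, add_mul, smul_mul_assoc, mul_smul_comm, hK, hL, h]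
  match_scalars
  · linear_combination -Real.cos_sq_add_sin_sq θ
  · ring

theorem homotopic_of_anticommute [StarRing A] [StarModule ℝ A] {Z : Type*} [TopologicalSpace Z]
    {P : A} (sP : star P = P) {f g : C(Z, OrthComplexStructure A)}
    (hf : ∀ z, (f z : A) * P = P * f z) (hg : ∀ z, (g z : A) * P = P * g z)
    (hP : P * P = P) (hfg : ∀ z, (1 - P) * (f z : A) = (1 - P) * g z)
    (h : ∀ z, P * ((f z : A) * g z) = -(P * ((g z : A) * f z))) : f.Homotopic g := by
  have hcorner : ∀ {a b : A}, a * P = P * a → (P * a) * (P * b) = P * (a * b) := by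
    intro a b ha
    rw [mul_assoc, ← mul_assoc a, ha, ← mul_assoc, ← mul_assoc, hP, mul_assoc]
  have hPQ : P * (1 - P) = 0 := by rw [mul_sub, mul_one, hP, sub_self]
  have hQP : (1 - P) * P = 0 := by rw [sub_mul, one_mul, hP, sub_self]
  have hQQ : (1 - P) * (1 - P) = 1 - P := by rw [sub_mul, one_mul, hPQ, sub_zero]
  have hfc : Continuous fun z => (f z : A) := continuous_subtype_val.comp f.continuous
  have hgc : Continuous fun z => (g z : A) := continuous_subtype_val.comp g.continuous
  let R : ℝ → Z → A := fun θ z => Real.cos θ • (P * (f z : A)) + Real.sin θ • (P * (g z : A))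
  have hR : ∀ θ z, R θ z * R θ z = -P := fun θ z => by
    refine cos_smul_add_sin_smul_mul_self θ ?_ ?_ ?_
    · rw [hcorner (hf z), (f z).2.2, mul_neg, mul_one]
    · rw [hcorner (hg z), (g z).2.2, mul_neg, mul_one]
    · rw [hcorner (hf z), hcorner (hg z), h z]
  have hPR : ∀ θ z, P * R θ z = R θ z := fun θ z => by
    simp only [R, mul_add, mul_smul_comm, ← mul_assoc, hP]
  have hRP : ∀ θ z, R θ z * P = R θ z := fun θ z => by
    simp only [R, add_mul, smul_mul_assoc, mul_assoc, hf, hg]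
    simp only [← mul_assoc, hP]
  have hfQ : ∀ z, (f z : A) * (1 - P) = (1 - P) * f z := fun z => by
    rw [mul_sub, sub_mul, hf, mul_one, one_mul]
  have hsum : ∀ a : A, (1 - P) * a + P * a = a := fun a => by rw [← add_mul]; simp
  refine ⟨{ toFun := fun p => ⟨(1 - P) * (f p.2 : A) + R (p.1 * (Real.pi / 2)) p.2, ?_, ?_⟩
            continuous_toFun := ?_, map_zero_left := fun z => ?_, map_one_left := fun z => ?_ }⟩
  · simp only [R, star_add, star_mul, star_sub, star_one, star_smul, star_trivial, sP,
      (f p.2).2.1, (g p.2).2.1, neg_mul, hf, hg, hfQ, smul_neg]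
    abel
  · have h1 : (1 - P) * (f p.2 : A) * R (p.1 * (Real.pi / 2)) p.2 = 0 := by
      rw [← hPR, ← hfQ, mul_assoc, ← mul_assoc (1 - P), hQP, zero_mul, mul_zero]
    have h2 : R (p.1 * (Real.pi / 2)) p.2 * ((1 - P) * (f p.2 : A)) = 0 := by
      rw [← hRP, mul_assoc, ← mul_assoc P, hPQ, zero_mul, mul_zero]
    have h3 : (1 - P) * (f p.2 : A) * ((1 - P) * (f p.2 : A)) = -(1 - P) := by
      rw [mul_assoc, ← mul_assoc (f p.2 : A), hfQ, ← mul_assoc, ← mul_assoc, hQQ, mul_assoc,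
        (f p.2).2.2, mul_neg, mul_one]
    have h4 := hR (p.1 * (Real.pi / 2)) p.2
    generalize R (p.1 * (Real.pi / 2)) p.2 = r at h1 h2 h4 ⊢
    rw [add_mul, mul_add, mul_add, h1, h2, h3, h4]
    abel
  · refine Continuous.subtype_mk ?_ _
    have h1 : Continuous fun p : unitInterval × Z => (f p.2 : A) := hfc.comp continuous_snd
    have h2 : Continuous fun p : unitInterval × Z => (g p.2 : A) := hgc.comp continuous_snd
    simp only [R]
    fun_prop
  · refine Subtype.ext ?_
    simp [R, hsum]
  · refine Subtype.ext ?_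
    simp [R, hfg, hsum]

end Anticommuting

variable {M : Type*} [NormedAddCommGroup M] [InnerProductSpace ℝ M]

local notation "ℓM" => lp (fun _ : ℕ => M) 2

theorem sum_norm_sign_smul_sq_le (σ : Equiv.Perm ℕ) (c : ℕ → SignType) (T : M →L[ℝ] M) (x : ℓM)
    (s : Finset ℕ) :
    ∑ n ∈ s, ‖(c n : ℝ) • T (x (σ n))‖ ^ (2 : ENNReal).toReal ≤
      (‖T‖ * ‖x‖) ^ (2 : ENNReal).toReal := by
  have hc : ∀ n, ‖(c n : ℝ)‖ ≤ 1 := fun n => by cases c n <;> simp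
  have h2 : 0 < (2 : ENNReal).toReal := by norm_num
  calc ∑ n ∈ s, ‖(c n : ℝ) • T (x (σ n))‖ ^ (2 : ENNReal).toReal
      ≤ ∑ n ∈ s, ‖T‖ ^ (2 : ENNReal).toReal * ‖x (σ n)‖ ^ (2 : ENNReal).toReal := by
        refine Finset.sum_le_sum fun n _ => ?_
        rw [← Real.mul_rpow (norm_nonneg _) (norm_nonneg _)]
        refine Real.rpow_le_rpow (norm_nonneg _) ?_ h2.le
        rw [norm_smul]
        exact (mul_le_of_le_one_left (norm_nonneg _) (hc n)).trans (T.le_opNorm _)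
    _ = ‖T‖ ^ (2 : ENNReal).toReal *
          ∑ n ∈ s.map σ.toEmbedding, ‖x n‖ ^ (2 : ENNReal).toReal := by
        rw [Finset.sum_map, Finset.mul_sum]; rfl
    _ ≤ ‖T‖ ^ (2 : ENNReal).toReal * ‖x‖ ^ (2 : ENNReal).toReal := by
        gcongr; exact lp.sum_rpow_le_norm_rpow h2 x _
    _ = _ := (Real.mul_rpow (norm_nonneg _) (norm_nonneg _)).symm

/-- The operator on `ℓ²(ℕ, M)` that permutes the coordinates by `σ`, multiplies them by the
signs `c`, and applies `T` to each of them. -/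
noncomputable def signedPerm (σ : Equiv.Perm ℕ) (c : ℕ → SignType) (T : M →L[ℝ] M) :
    ℓM →L[ℝ] ℓM :=
  LinearMap.mkContinuous
    { toFun := fun x => ⟨fun n => (c n : ℝ) • T (x (σ n)),
        memℓp_gen' (sum_norm_sign_smul_sq_le σ c T x)⟩
      map_add' := fun x y => by ext n; simp; rfl
      map_smul' := fun a x => by ext n; simp [smul_comm a] }
    ‖T‖ fun x => lp.norm_le_of_forall_sum_le (by norm_num) (by positivity)
      (sum_norm_sign_smul_sq_le σ c T x)

@[simp]
theorem signedPerm_apply (σ : Equiv.Perm ℕ) (c : ℕ → SignType) (T : M →L[ℝ] M) (x : ℓM) (n : ℕ) :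
    signedPerm σ c T x n = (c n : ℝ) • T (x (σ n)) := rfl

theorem continuous_signedPerm (σ : Equiv.Perm ℕ) (c : ℕ → SignType) :
    Continuous (signedPerm (M := M) σ c) := by
  refine LipschitzWith.continuous (K := 1) (f := signedPerm (M := M) σ c)
    (LipschitzWith.of_dist_le_mul fun S T => ?_)
  have : signedPerm σ c S - signedPerm σ c T = signedPerm σ c (S - T) := by
    ext x n; simp [smul_sub]
  rw [dist_eq_norm, dist_eq_norm, this, NNReal.coe_one, one_mul]
  exact LinearMap.mkContinuous_norm_le _ (norm_nonneg _) _

theorem signedPerm_mul (σ τ : Equiv.Perm ℕ) (c d : ℕ → SignType) (S T : M →L[ℝ] M) :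
    signedPerm σ c S * signedPerm τ d T =
      signedPerm (τ * σ) (fun n => c n * d (σ n)) (S * T) := by
  ext x n; simp [mul_smul]

theorem neg_signedPerm (σ : Equiv.Perm ℕ) (c : ℕ → SignType) (T : M →L[ℝ] M) :
    -signedPerm σ c T = signedPerm σ (fun n => -c n) T := by
  ext x n; simp

/-- The involution of `ℕ` that exchanges `2 k` and `2 k + 1`. -/
def swapEven : Equiv.Perm ℕ :=
  Function.Involutive.toPerm (fun n => if n % 2 = 0 then n + 1 else n - 1) fun n => by grind

/-- The involution of `ℕ` that fixes `0` and exchanges `2 k + 1` and `2 k + 2`. -/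
def swapOdd : Equiv.Perm ℕ :=
  Function.Involutive.toPerm (fun n => if n = 0 then 0 else if n % 2 = 1 then n + 1 else n - 1)
    fun n => by grind

/-- The sign `(-1) ^ n`. -/
def parity (n : ℕ) : SignType := if n % 2 = 0 then 1 else -1

theorem parity_mul_self (n : ℕ) : parity n * parity n = 1 := by
  rw [parity]; split <;> rfl

theorem swapEven_swapEven (n : ℕ) : swapEven (swapEven n) = n :=
  swapEven.left_inv n

theorem swapOdd_swapOdd (n : ℕ) : swapOdd (swapOdd n) = n :=
  swapOdd.left_inv n

theorem parity_swapEven (n : ℕ) : parity (swapEven n) = -parity n := by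
  change parity (if n % 2 = 0 then n + 1 else n - 1) = _
  rcases Nat.mod_two_eq_zero_or_one n with h | h
  · have h1 : (n + 1) % 2 = 1 := by omega
    simp [parity, h, h1]
  · have h1 : (n - 1) % 2 = 0 := by omega
    simp [parity, h, h1]

theorem parity_swapOdd {n : ℕ} (h0 : n ≠ 0) : parity (swapOdd n) = -parity n := by
  change parity (if n = 0 then 0 else if n % 2 = 1 then n + 1 else n - 1) = _
  rcases Nat.mod_two_eq_zero_or_one n with h | h
  · have h1 : (n - 1) % 2 = 1 := by omega
    simp [parity, h, h1, h0]
  · have h1 : (n + 1) % 2 = 0 := by omega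
    simp [parity, h, h1, h0]

theorem swapOdd_zero : swapOdd 0 = 0 := rfl

theorem swapOdd_eq_zero_iff {n : ℕ} : swapOdd n = 0 ↔ n = 0 := by
  rw [← swapOdd.injective.eq_iff (a := n), swapOdd_zero]

variable (M) in
/-- The projection of `ℓ²(ℕ, M)` onto the sequences that vanish at `0`. -/
noncomputable def tailProj : ℓM →L[ℝ] ℓM := signedPerm 1 (fun n => if n = 0 then 0 else 1) 1

variable (M) in
/-- The complex structure on the range of `tailProj M` that rotates the pairs of coordinates
`2 k + 1` and `2 k + 2`. -/
noncomputable def tailStructure : ℓM →L[ℝ] ℓM :=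
  signedPerm swapOdd (fun n => if n = 0 then 0 else parity n) 1

theorem tailProj_mul_self : tailProj M * tailProj M = tailProj M := by
  ext x n; by_cases h : n = 0 <;> simp [tailProj, h]

theorem tailProj_mul_tailStructure : tailProj M * tailStructure M = tailStructure M := by
  ext x n; by_cases h : n = 0 <;> simp [tailProj, tailStructure, h]

theorem tailStructure_mul_tailProj : tailStructure M * tailProj M = tailStructure M := by
  ext x n; by_cases h : n = 0 <;> simp [tailProj, tailStructure, h, swapOdd_eq_zero_iff]

theorem tailStructure_mul_self : tailStructure M * tailStructure M = -tailProj M := by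
  simp only [tailStructure, signedPerm_mul, tailProj, neg_signedPerm, mul_one]
  congr 1
  · ext n; exact swapOdd_swapOdd n
  · funext n
    by_cases h : n = 0 <;> simp [h, swapOdd_eq_zero_iff, parity_swapOdd, parity_mul_self]

theorem one_sub_tailProj_apply (x : ℓM) : (1 - tailProj M) x = lp.single 2 0 (x 0) := by
  ext n
  by_cases h : n = 0
  · subst h; simp [tailProj]
  · simp [tailProj, h]

/-- The block of an operator on `ℓ²(ℕ, M)` at the coordinate `0`. -/
noncomputable def headBlock (J : ℓM →L[ℝ] ℓM) : M →L[ℝ] M :=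
  lp.evalCLM ℝ (fun _ : ℕ => M) 2 0 ∘L J ∘L lp.singleContinuousLinearMap ℝ (fun _ : ℕ => M) 2 0

theorem headBlock_apply (J : ℓM →L[ℝ] ℓM) (a : M) : headBlock J a = J (lp.single 2 0 a) 0 := rfl

theorem continuous_headBlock : Continuous (headBlock (M := M)) := by
  unfold headBlock; fun_prop

theorem tailStructure_single_zero (a : M) : tailStructure M (lp.single 2 0 a) = 0 := by
  have h : (1 - tailProj M) (lp.single 2 0 a) = lp.single 2 0 a := by
    rw [one_sub_tailProj_apply, lp.single_apply_self]
  rw [← h, ← mul_apply_eq_comp, mul_sub, mul_one, tailStructure_mul_tailProj, sub_self]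
  rfl

theorem apply_single_zero_eq_single_headBlock {J : ℓM →L[ℝ] ℓM}
    (hPJ : tailProj M * J = tailStructure M) (a : M) :
    J (lp.single 2 0 a) = lp.single 2 0 (headBlock J a) := by
  have h := one_sub_tailProj_apply (J (lp.single 2 0 a))
  rwa [_root_.sub_apply, one_apply_eq_self, ← mul_apply_eq_comp, hPJ,
    tailStructure_single_zero, sub_zero] at h

theorem apply_zero_eq_headBlock {J : ℓM →L[ℝ] ℓM}
    (hJP : J * tailProj M = tailStructure M) (x : ℓM) : J x 0 = headBlock J (x 0) := by
  have h : J x = J ((1 - tailProj M) x) + (J * tailProj M) x := by simp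
  rw [h, hJP, one_sub_tailProj_apply, headBlock_apply]
  simp [tailStructure]

variable [CompleteSpace M]

theorem star_signedPerm {σ : Equiv.Perm ℕ} (hσ : ∀ n, σ (σ n) = n) (c : ℕ → SignType)
    (T : M →L[ℝ] M) :
    star (signedPerm σ c T) = signedPerm σ (fun n => c (σ n)) (star T) := by
  refine ((ContinuousLinearMap.eq_adjoint_iff _ _).2 fun x y => ?_).symm
  rw [lp.inner_eq_tsum, lp.inner_eq_tsum, ← σ.tsum_eq]
  refine tsum_congr fun n => ?_
  simp [hσ, star_eq_adjoint, adjoint_inner_left, inner_smul_left, inner_smul_right]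

theorem star_tailProj : star (tailProj M) = tailProj M := by
  rw [tailProj, star_signedPerm (fun n => rfl), star_one]; rfl

theorem star_tailStructure : star (tailStructure M) = -tailStructure M := by
  rw [tailStructure, star_signedPerm swapOdd_swapOdd, neg_signedPerm, star_one]
  congr 1
  funext n
  by_cases h : n = 0 <;> simp [h, swapOdd_eq_zero_iff, parity_swapOdd]

variable (M) in
/-- The complex structure on `ℓ²(ℕ, M)` that rotates the pairs of coordinates `2 k`
and `2 k + 1`. -/
noncomputable def pairStructure : OrthComplexStructure (ℓM →L[ℝ] ℓM) :=
  ⟨signedPerm swapEven (fun n => -parity n) 1, by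
    rw [star_signedPerm swapEven_swapEven, neg_signedPerm, star_one]
    simp only [parity_swapEven], by
    ext x n
    simp [signedPerm_mul, parity_swapEven, parity_mul_self, swapEven_swapEven, -SignType.coe_mul]⟩

/-- The complex structure on `ℓ²(ℕ, M)` that is `T` on the even coordinates and `-T` on the odd
ones. -/
noncomputable def alternatingStructure (T : OrthComplexStructure (M →L[ℝ] M)) :
    OrthComplexStructure (ℓM →L[ℝ] ℓM) :=
  ⟨signedPerm 1 parity T, by
    rw [star_signedPerm (fun n => rfl), T.2.1]
    ext x n; simp, by
    rw [signedPerm_mul, T.2.2]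
    ext x n; simp [parity_mul_self, -SignType.coe_mul]⟩

theorem continuous_alternatingStructure : Continuous (alternatingStructure (M := M)) :=
  ((continuous_signedPerm 1 parity).comp continuous_subtype_val).subtype_mk _

theorem alternatingStructure_mul_tailProj (T : OrthComplexStructure (M →L[ℝ] M)) :
    (alternatingStructure T : ℓM →L[ℝ] ℓM) * tailProj M =
      tailProj M * alternatingStructure T := by
  simp only [alternatingStructure, tailProj, signedPerm_mul, mul_one, one_mul]
  congr 1
  funext n
  exact mul_comm _ _

theorem alternatingStructure_mul_pairStructure (T : OrthComplexStructure (M →L[ℝ] M)) :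
    (alternatingStructure T : ℓM →L[ℝ] ℓM) * pairStructure M =
      -(pairStructure M * alternatingStructure T) := by
  simp only [alternatingStructure, pairStructure, signedPerm_mul, neg_signedPerm, mul_one, one_mul]
  congr 1
  funext n
  simp [parity_swapEven]

theorem alternatingStructure_mul_tailStructure (T : OrthComplexStructure (M →L[ℝ] M)) :
    (alternatingStructure T : ℓM →L[ℝ] ℓM) * tailStructure M =
      -(tailStructure M * alternatingStructure T) := by
  simp only [alternatingStructure, tailStructure, signedPerm_mul, neg_signedPerm, mul_one, one_mul]
  congr 1
  funext n
  by_cases h : n = 0 <;> simp [h, parity_swapOdd]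

/-- The restriction to the coordinate `0` of a complex structure that commutes with `tailProj M`. -/
noncomputable def headStructure (J : OrthComplexStructure (ℓM →L[ℝ] ℓM))
    (hPJ : tailProj M * (J : ℓM →L[ℝ] ℓM) = tailStructure M) :
    OrthComplexStructure (M →L[ℝ] M) :=
  ⟨headBlock J, by
    refine ((ContinuousLinearMap.eq_adjoint_iff _ _).2 fun a b => ?_).symm
    have h : inner ℝ ((J : ℓM →L[ℝ] ℓM) (lp.single 2 0 a)) (lp.single 2 0 b) =
        inner ℝ (lp.single 2 0 a) (-(J : ℓM →L[ℝ] ℓM) (lp.single 2 0 b)) := by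
      rw [← _root_.neg_apply, ← J.2.1, star_eq_adjoint, adjoint_inner_right]
    rw [lp.inner_single_right, lp.inner_single_left] at h
    rw [_root_.neg_apply, inner_neg_left, headBlock_apply, headBlock_apply, h]
    simp, by
    ext a
    have h := congrArg (fun L => L (lp.single 2 0 a) 0) J.2.2
    simpa [apply_single_zero_eq_single_headBlock hPJ] using h⟩

theorem nullhomotopic_of_norm_tailProj_mul_mul_le {Z : Type*} [TopologicalSpace Z]
    (f : C(Z, OrthComplexStructure (ℓM →L[ℝ] ℓM)))
    (hf : ∀ z, ‖tailProj M * (f z : ℓM →L[ℝ] ℓM) * tailProj M‖ ≤ 1 / 100) :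
    f.Nullhomotopic := by
  obtain ⟨g, hfg, hg⟩ := exists_homotopic_mul_eq (pairStructure M) star_tailProj
    tailProj_mul_self star_tailStructure tailStructure_mul_self tailProj_mul_tailStructure
    tailStructure_mul_tailProj f hf
  let D : C(Z, OrthComplexStructure (ℓM →L[ℝ] ℓM)) :=
    ⟨fun z => alternatingStructure (headStructure (g z) (hg z).2),
      continuous_alternatingStructure.comp ((continuous_headBlock.comp
        (continuous_subtype_val.comp g.continuous)).subtype_mk _)⟩
  have hD : ∀ z, D z = alternatingStructure (headStructure (g z) (hg z).2) := fun z => rfl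
  refine ⟨pairStructure M, hfg.trans (Homotopic.trans (g := D) ?_ ?_)⟩
  · refine homotopic_of_anticommute star_tailProj (fun z => by rw [(hg z).1, (hg z).2])
      (fun z => alternatingStructure_mul_tailProj _) tailProj_mul_self (fun z => ?_) fun z => ?_
    · ext1 x
      rw [mul_apply_eq_comp, mul_apply_eq_comp, one_sub_tailProj_apply, one_sub_tailProj_apply,
        apply_zero_eq_headBlock (hg z).1]
      simp [D, alternatingStructure, headStructure, parity]
    · rw [hD]
      generalize headStructure (g z) (hg z).2 = T
      rw [← mul_assoc, (hg z).2, ← mul_assoc, ← alternatingStructure_mul_tailProj, mul_assoc,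
        (hg z).2, alternatingStructure_mul_tailStructure, neg_neg]
  · refine homotopic_of_anticommute (P := 1) (star_one _) (by simp) (by simp) (by simp) (by simp)
      fun z => ?_
    rw [one_mul, one_mul]
    exact alternatingStructure_mul_pairStructure _

end Swindle

section CompactFamilies

open ContinuousLinearMap

variable {H : Type*} [NormedAddCommGroup H] [InnerProductSpace ℝ H]

theorem Orthonormal.countable [TopologicalSpace.SeparableSpace H] {ι : Type*} {v : ι → H}
    (hv : Orthonormal ℝ v) : Countable ι := by
  refine Set.countable_univ_iff.1 (Set.PairwiseDisjoint.countable_of_isOpen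
    (s := fun i => Metric.ball (v i) (1 / 2)) (fun i _ j _ hij => ?_)
    (fun i _ => Metric.isOpen_ball) fun i _ => ⟨v i, Metric.mem_ball_self (by norm_num)⟩)
  refine Metric.ball_disjoint_ball ?_
  have h : ‖v i - v j‖ ^ 2 = 2 := by
    rw [norm_sub_sq_real, hv.1, hv.1, hv.2 hij]; norm_num
  rw [dist_eq_norm]
  nlinarith [norm_nonneg (v i - v j)]

theorem HilbertBasis.norm_le_of_abs_inner_le {ι : Type*} (b : HilbertBasis ι ℝ H) {w : ι → ℝ}
    (hw : Summable w) {v : H} (hv : ∀ i, |inner ℝ (b i) v| ≤ w i) : ‖v‖ ≤ ∑' i, w i := by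
  refine (b.hasSum_repr v).norm_le_of_bounded hw.hasSum fun i => ?_
  rw [norm_smul, b.orthonormal.1, mul_one, b.repr_apply_apply]
  exact hv i

theorem HilbertBasis.opNorm_le_of_abs_inner_le {ι : Type*} (b : HilbertBasis ι ℝ H) {w : ι → ℝ}
    (hw : Summable w) (hw0 : ∀ i, 0 ≤ w i) {T : H →L[ℝ] H}
    (hT : ∀ i j, |inner ℝ (b i) (T (b j))| ≤ w i * w j) : ‖T‖ ≤ (∑' i, w i) ^ 2 := by
  have hS : 0 ≤ ∑' i, w i := tsum_nonneg hw0
  refine T.opNorm_le_bound (sq_nonneg _) fun x => ?_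
  have h := ((b.hasSum_repr x).mapL T).norm_le_of_bounded
    ((hw.mul_left ((∑' i, w i) * ‖x‖)).hasSum) fun j => ?_
  · rw [tsum_mul_left] at h
    linarith
  · have hj : ‖T (b j)‖ ≤ (∑' i, w i) * w j := by
      rw [← tsum_mul_right]
      exact b.norm_le_of_abs_inner_le (hw.mul_right _) fun i => hT i j
    have hx : ‖b.repr x j‖ ≤ ‖x‖ := by
      rw [b.repr_apply_apply]
      simpa [b.orthonormal.1] using norm_inner_le_norm (𝕜 := ℝ) (b j) x
    rw [map_smul, norm_smul]
    calc ‖b.repr x j‖ * ‖T (b j)‖ ≤ ‖x‖ * ((∑' i, w i) * w j) := by gcongr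
      _ = _ := by ring

theorem Orthonormal.tendsto_inner_zero {e : ℕ → H} (he : Orthonormal ℝ e) (v : H) :
    Tendsto (fun n => inner ℝ v (e n)) atTop (𝓝 0) := by
  have h := (he.inner_products_summable v).tendsto_atTop_zero
  rw [tendsto_zero_iff_abs_tendsto_zero]
  simpa [Function.comp_def, real_inner_comm, Real.sqrt_sq_eq_abs] using h.sqrt

variable [CompleteSpace H]

theorem HilbertBasis.exists_reindex {ι ι' : Type*} (b : HilbertBasis ι ℝ H) (e : ι' ≃ ι) :
    ∃ b' : HilbertBasis ι' ℝ H, ∀ i, b' i = b (e i) := by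
  refine ⟨HilbertBasis.mk (b.orthonormal.comp e e.injective) ?_, fun i => ?_⟩
  · rw [Set.range_comp, e.surjective.range_eq, Set.image_univ, b.dense_span]
  · simp

theorem exists_hilbertBasis_nat [TopologicalSpace.SeparableSpace H]
    (hinf : ¬FiniteDimensional ℝ H) : Nonempty (HilbertBasis ℕ ℝ H) := by
  obtain ⟨w, b, -⟩ := exists_hilbertBasis ℝ H
  have hc : Countable w := b.orthonormal.countable
  have hi : Infinite w := by
    by_contra hw
    rw [not_infinite_iff_finite] at hw
    have := Fintype.ofFinite w
    exact hinf b.toOrthonormalBasis.toBasis.finiteDimensional_of_finite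
  obtain ⟨e⟩ := nonempty_equiv_of_countable (α := ℕ) (β := w)
  obtain ⟨b₀, -⟩ := b.exists_reindex e
  exact ⟨b₀⟩

/-- For finitely many skew-adjoint operators there is a sparse subsequence of an orthonormal
sequence along which all of them have small matrix coefficients. -/
theorem exists_strictMono_abs_inner_le {e : ℕ → H} (he : Orthonormal ℝ e)
    {N : Set (H →L[ℝ] H)} (hN : N.Finite) (hskew : ∀ J ∈ N, star J = -J) {u : ℕ → ℝ}
    (hu : ∀ k, 0 < u k) (hanti : Antitone u) :
    ∃ m : ℕ → ℕ, StrictMono m ∧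
      ∀ J ∈ N, ∀ k l, |inner ℝ (e (m k)) (J (e (m l)))| ≤ u k * u l := by
  obtain ⟨f, -, hf⟩ := exists_seq_of_forall_finset_exists (α := ℕ × ℕ) (fun _ => True)
    (fun p q => p.1 < q.1 ∧ p.2 < q.2 ∧
      ∀ J ∈ N, |inner ℝ (e p.2) (J (e q.2))| ≤ u p.1 * u q.1) fun s _ => by
    obtain ⟨k, hk⟩ : ∃ k, ∀ p ∈ s, p.1 < k :=
      ⟨s.sup Prod.fst + 1, fun p hp => Nat.lt_succ_of_le (Finset.le_sup (f := Prod.fst) hp)⟩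
    have hev : ∀ᶠ n in atTop, ∀ p ∈ s, p.2 < n ∧
        ∀ J ∈ N, |inner ℝ (e p.2) (J (e n))| ≤ u p.1 * u k := by
      rw [Filter.eventually_all_finset]
      refine fun p _ => (eventually_gt_atTop p.2).and ?_
      rw [Filter.eventually_all_finite hN]
      intro J hJ
      have h := (he.tendsto_inner_zero (star J (e p.2))).abs
      rw [abs_zero] at h
      filter_upwards [h.eventually (ge_mem_nhds (mul_pos (hu p.1) (hu k)))] with n hn
      rwa [star_eq_adjoint, adjoint_inner_left] at hn
    obtain ⟨n, hn⟩ := hev.exists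
    exact ⟨(k, n), trivial, fun p hp => ⟨hk p hp, hn p hp⟩⟩
  have hmono : StrictMono fun i => (f i).1 := fun i j hij => (hf i j hij).1
  have hle : ∀ i, u (f i).1 ≤ u i := fun i => hanti (hmono.id_le i)
  have hlt : ∀ J ∈ N, ∀ k l, k < l → |inner ℝ (e (f k).2) (J (e (f l).2))| ≤ u k * u l :=
    fun J hJ k l hkl => ((hf k l hkl).2.2 J hJ).trans
      (mul_le_mul (hle k) (hle l) (hu _).le (hu _).le)
  have hsymm : ∀ J ∈ N, ∀ x y : H, inner ℝ x (J y) = -inner ℝ y (J x) := fun J hJ x y => by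
    rw [← adjoint_inner_left, ← star_eq_adjoint, hskew J hJ, neg_apply, inner_neg_left,
      real_inner_comm]
  refine ⟨fun i => (f i).2, fun i j hij => (hf i j hij).2.1, fun J hJ k l => ?_⟩
  rcases lt_trichotomy k l with h | rfl | h
  · exact hlt J hJ k l h
  · have h := hsymm J hJ (e (f k).2) (e (f k).2)
    rw [self_eq_neg.1 h, abs_zero]
    exact (mul_pos (hu k) (hu k)).le
  · rw [hsymm J hJ, abs_neg, mul_comm]
    exact hlt J hJ l k h

end CompactFamilies

section CompactNullhomotopy

open ContinuousMap ContinuousLinearMap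

theorem exists_equiv_mem_iff {α β : Type*} [Countable α] [Countable β] {s : Set α} {t : Set β}
    (hs : s.Infinite) (hs' : sᶜ.Infinite) (ht : t.Infinite) (ht' : tᶜ.Infinite) :
    ∃ e : α ≃ β, ∀ a, e a ∈ t ↔ a ∈ s := by
  classical
  have := hs.to_subtype
  have := hs'.to_subtype
  have := ht.to_subtype
  have := ht'.to_subtype
  obtain ⟨e₁⟩ := nonempty_equiv_of_countable (α := s) (β := t)
  obtain ⟨e₂⟩ := nonempty_equiv_of_countable (α := ↥sᶜ) (β := ↥tᶜ)
  refine ⟨(Equiv.Set.sumCompl s).symm.trans ((e₁.sumCongr e₂).trans (Equiv.Set.sumCompl t)),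
    fun a => ?_⟩
  by_cases ha : a ∈ s
  · simp [Equiv.Set.sumCompl_symm_apply_of_mem ha, ha]
  · have h : (e₂ ⟨a, ha⟩ : β) ∉ t := (e₂ ⟨a, ha⟩).2
    simp [Equiv.Set.sumCompl_symm_apply_of_notMem ha, ha, h]

theorem norm_mul_add_mul_le {A : Type*} [NormedRing A] {P a b : A} (hP : ‖P‖ ≤ 1) :
    ‖P * (a + b) * P‖ ≤ ‖P * a * P‖ + ‖b‖ := by
  rw [mul_add, add_mul]
  refine (norm_add_le _ _).trans (add_le_add_right ?_ _)
  calc ‖P * b * P‖ ≤ 1 * ‖b‖ * 1 := norm_mul₃_le.trans (by gcongr)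
    _ = ‖b‖ := by ring

variable {H : Type*} [NormedAddCommGroup H] [InnerProductSpace ℝ H]

/-- Conjugation by an isometry, as a map between spaces of orthogonal complex structures. -/
noncomputable def LinearIsometryEquiv.conjOrthComplexStructure {G : Type*} [NormedAddCommGroup G]
    [InnerProductSpace ℝ G] [CompleteSpace H] [CompleteSpace G] (Ψ : H ≃ₗᵢ[ℝ] G) :
    C(OrthComplexStructure (H →L[ℝ] H), OrthComplexStructure (G →L[ℝ] G)) where
  toFun J := ⟨Ψ.conjStarAlgEquiv J, by
    rw [← map_neg, ← J.2.1]
    exact (Ψ.conjStarAlgEquiv.map_star' _).symm, by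
    rw [← map_mul, J.2.2, map_neg, map_one]⟩
  continuous_toFun := by
    refine Continuous.subtype_mk ?_ _
    simp only [LinearIsometryEquiv.conjStarAlgEquiv_apply]
    fun_prop

variable [CompleteSpace H]

theorem exists_hilbertBasis_lp {ι : Type*} (e : HilbertBasis ι ℝ H) :
    ∃ g : HilbertBasis (ℕ × ι) ℝ (lp (fun _ : ℕ => H) 2),
      ∀ p, g p = lp.single 2 p.1 (e p.2) := by
  classical
  have ho : Orthonormal ℝ fun p : ℕ × ι =>
      (lp.single 2 p.1 (e p.2) : lp (fun _ : ℕ => H) 2) := by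
    rw [orthonormal_iff_ite]
    rintro ⟨n, i⟩ ⟨m, j⟩
    rw [lp.inner_single_left, lp.single_apply]
    by_cases h : n = m
    · subst h
      simpa using orthonormal_iff_ite.1 e.orthonormal i j
    · rw [Pi.single_eq_of_ne h, inner_zero_right, if_neg fun h' => h (congrArg Prod.fst h')]
  refine ⟨HilbertBasis.mkOfOrthogonalEqBot ho ?_, fun p => by
    rw [HilbertBasis.coe_mkOfOrthogonalEqBot]⟩
  rw [Submodule.eq_bot_iff]
  intro f hf
  ext n
  refine e.repr.injective ?_
  ext i
  have := Submodule.inner_right_of_mem_orthogonal 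
    (Submodule.subset_span (Set.mem_range_self (n, i))) hf
  rw [lp.inner_single_left] at this
  rw [e.repr_apply_apply]
  simpa using this

/-- Finitely many skew-adjoint operators are simultaneously almost zero on an infinite-dimensional
and infinite-codimensional subspace. -/
theorem exists_norm_tailProj_mul_conj_mul_le [TopologicalSpace.SeparableSpace H]
    (hinf : ¬FiniteDimensional ℝ H) {N : Set (H →L[ℝ] H)} (hN : N.Finite)
    (hskew : ∀ J ∈ N, star J = -J) :
    ∃ Ψ : H ≃ₗᵢ[ℝ] lp (fun _ : ℕ => H) 2,
      ∀ J ∈ N, ‖tailProj H * Ψ.conjStarAlgEquiv J * tailProj H‖ ≤ 1 / 400 := by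
  obtain ⟨e⟩ := exists_hilbertBasis_nat hinf
  let u : ℕ → ℝ := fun k => 1 / 40 * (1 / 2) ^ k
  have hu : ∀ k, 0 < u k := fun k => by positivity
  have hsum : HasSum u (1 / 20) := by
    convert! hasSum_geometric_two.mul_left (1 / 40 : ℝ) using 1; norm_num
  obtain ⟨m, hm, hmN⟩ := exists_strictMono_abs_inner_le
    (e.orthonormal.comp (fun k => 2 * k + 1) fun a b h => by simpa using h) hN hskew hu
    fun a b h => mul_le_mul_of_nonneg_left
      (pow_le_pow_of_le_one (by norm_num) (by norm_num) h) (by norm_num)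
  let μ : ℕ → ℕ := fun k => 2 * m k + 1
  have hμ : Function.Injective μ := fun a b h => hm.injective (by simpa [μ] using h)
  obtain ⟨β, hβ⟩ := exists_equiv_mem_iff (α := ℕ × ℕ) (β := ℕ) (s := {p | p.1 ≠ 0})
    (t := Set.range μ)
    (Set.infinite_of_injective_forall_mem (f := fun n : ℕ => (n + 1, 0))
      (fun a b h => by simpa using h) fun n => by simp)
    (Set.infinite_of_injective_forall_mem (f := fun n : ℕ => (0, n))
      (fun a b h => by simpa using h) fun n => by simp)
    (Set.infinite_range_of_injective hμ)
    (Set.infinite_of_injective_forall_mem (f := fun n : ℕ => 2 * n)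
      (fun a b h => by simpa using h) fun n => by
        rintro ⟨k, hk⟩
        simp only [μ] at hk
        omega)
  obtain ⟨g, hg⟩ := exists_hilbertBasis_lp e
  obtain ⟨e', he'⟩ := e.exists_reindex β
  let Ψ : H ≃ₗᵢ[ℝ] lp (fun _ : ℕ => H) 2 := e'.repr.trans g.repr.symm
  have hΨ : ∀ p, Ψ.symm (g p) = e (β p) := fun p => by
    rw [← he' p, LinearIsometryEquiv.symm_apply_eq]
    simp [Ψ, e'.repr_self]
  have hP : ∀ p, tailProj H (g p) = if p.1 = 0 then 0 else g p := fun p => by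
    rw [hg]
    split_ifs with h <;> ext n <;> by_cases hn : n = 0 <;>
      simp [tailProj, lp.single_apply, Pi.single_apply, h, hn]
  let W : ℕ → ℝ := Function.extend μ u 0
  have hW : HasSum W (1 / 20) := (hμ.hasSum_iff fun x hx => by
    simp [W, Function.extend_apply' _ _ _ hx]).1 (by
      simpa only [W, Function.comp_def, hμ.extend_apply] using hsum)
  have hW0 : ∀ i, 0 ≤ W i := fun i => by
    by_cases hi : i ∈ Set.range μ
    · obtain ⟨k, rfl⟩ := hi
      simpa only [W, hμ.extend_apply] using (hu k).le
    · simp [W, Function.extend_apply' _ _ _ hi]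
  have hWβ : HasSum (fun p => W (β p)) (1 / 20) := β.hasSum_iff.2 hW
  refine ⟨Ψ, fun J hJ => ?_⟩
  have key := g.opNorm_le_of_abs_inner_le (T := tailProj H * Ψ.conjStarAlgEquiv J * tailProj H)
    hWβ.summable (fun p => hW0 _) fun p q => ?_
  · rw [hWβ.tsum_eq] at key
    exact key.trans (by norm_num)
  · rw [mul_apply_eq_comp, mul_apply_eq_comp, ← adjoint_inner_left, ← star_eq_adjoint,
      star_tailProj, hP, hP]
    by_cases hp : p.1 = 0
    · simpa [hp] using mul_nonneg (hW0 _) (hW0 _)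
    by_cases hq : q.1 = 0
    · simpa [hq] using mul_nonneg (hW0 _) (hW0 _)
    obtain ⟨k, hk⟩ := (hβ p).2 hp
    obtain ⟨l, hl⟩ := (hβ q).2 hq
    rw [if_neg hp, if_neg hq, Ψ.conjStarAlgEquiv_apply_apply, hΨ,
      ← Ψ.symm.inner_map_map, Ψ.symm_apply_apply, hΨ, ← hk, ← hl]
    simpa only [W, hμ.extend_apply, μ, Function.comp_apply] using hmN J hJ k l

theorem nullhomotopic_of_compactSpace [TopologicalSpace.SeparableSpace H]
    (hinf : ¬FiniteDimensional ℝ H) {K : Type*} [TopologicalSpace K] [CompactSpace K]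
    (f : C(K, OrthComplexStructure (H →L[ℝ] H))) : f.Nullhomotopic := by
  obtain ⟨N, hNf, hN, hcov⟩ := (isCompact_range f.continuous).finite_cover_balls
    (e := 1 / 200) (by norm_num)
  obtain ⟨Ψ, hΨ⟩ := exists_norm_tailProj_mul_conj_mul_le hinf (hN.image Subtype.val)
    (by rintro _ ⟨J, -, rfl⟩; exact J.2.1)
  have hg : (Ψ.conjOrthComplexStructure.comp f).Nullhomotopic := by
    refine nullhomotopic_of_norm_tailProj_mul_mul_le _ fun z => ?_
    obtain ⟨J, hJN, hJ⟩ := Set.mem_iUnion₂.1 (hcov ⟨z, rfl⟩)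
    have hP : ‖tailProj H‖ ≤ 1 :=
      norm_le_one_of_star_mul_self_eq_self (e := tailProj H)
        (by rw [star_tailProj, tailProj_mul_self])
    have h1 := hΨ J ⟨J, hJN, rfl⟩
    have h2 : ‖Ψ.conjStarAlgEquiv ((f z : H →L[ℝ] H) - J)‖ ≤ 1 / 200 := by
      refine opNorm_le_bound _ (by norm_num) fun x => ?_
      rw [Ψ.conjStarAlgEquiv_apply_apply, Ψ.norm_map, ← Ψ.symm.norm_map x]
      refine (le_opNorm _ _).trans ?_
      gcongr
      rw [← dist_eq_norm]
      exact (Metric.mem_ball.1 hJ).le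
    have h3 := norm_mul_add_mul_le (a := Ψ.conjStarAlgEquiv J)
      (b := Ψ.conjStarAlgEquiv ((f z : H →L[ℝ] H) - J)) hP
    rw [← map_add, add_sub_cancel] at h3
    exact h3.trans (by linarith)
  have h := hg.comp_right Ψ.symm.conjOrthComplexStructure
  convert h using 1
  ext z : 2
  exact (Ψ.conjStarAlgEquiv.symm_apply_apply _).symm

end CompactNullhomotopy

section Extension

/-- If all maps from the unit sphere `B` of a gauge `ρ` centred at `c` are nullhomotopic, then they
extend to the unit ball `D` of `ρ`. -/
theorem exists_continuousOn_eqOn_of_nullhomotopic {V Y : Type*} [AddCommGroup V] [Module ℝ V]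
    [TopologicalSpace V] [T2Space V] [IsTopologicalAddGroup V] [ContinuousSMul ℝ V]
    [TopologicalSpace Y] {A B D : Set V} {c : V} {ρ : V → ℝ}
    (hA : ∀ x ∈ A, ∀ a : ℝ, c + a • (x - c) ∈ A)
    (hρ : ∀ x, ∀ a : ℝ, 0 ≤ a → ρ (c + a • (x - c)) = a * ρ x)
    (hρ0 : ∀ x ∈ A, ρ x ≤ 0 → x = c) (hB : ∀ x, x ∈ B ↔ x ∈ A ∧ ρ x = 1)
    (hD : ∀ x, x ∈ D ↔ x ∈ A ∧ ρ x ≤ 1) (hne : B.Nonempty) [CompactSpace B]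
    (hnull : ∀ g : C(B, Y), g.Nullhomotopic) {f : V → Y} (hf : ContinuousOn f B) :
    ∃ G : V → Y, ContinuousOn G D ∧ Set.EqOn G f B := by
  classical
  obtain ⟨y, ⟨h⟩⟩ := hnull ⟨B.domRestrict f, hf.domRestrict⟩
  have hρq : ∀ z : unitInterval × B, ρ (c + (1 - z.1 : ℝ) • ((z.2 : V) - c)) = 1 - z.1 :=
    fun z => by rw [hρ _ _ (sub_nonneg.2 z.1.2.2), ((hB _).1 z.2.2).2, mul_one]
  let q : C(unitInterval × B, D) :=
    ⟨fun z => ⟨c + (1 - z.1 : ℝ) • ((z.2 : V) - c), (hD _).2 ⟨hA _ ((hB _).1 z.2.2).1 _, by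
      rw [hρq]; linarith [z.1.2.1]⟩⟩, by fun_prop⟩
  have hqsurj : Function.Surjective q := by
    rintro ⟨x, hx⟩
    obtain ⟨hxA, hx1⟩ := (hD x).1 hx
    rcases le_or_gt (ρ x) 0 with h0 | h0
    · obtain ⟨b, hb⟩ := hne
      refine ⟨(1, ⟨b, hb⟩), Subtype.ext ?_⟩
      simp [q, hρ0 x hxA h0]
    · refine ⟨(⟨1 - ρ x, by linarith, by linarith⟩,
        ⟨c + (ρ x)⁻¹ • (x - c), (hB _).2 ⟨hA _ hxA _, ?_⟩⟩), Subtype.ext ?_⟩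
      · rw [hρ _ _ (inv_pos.2 h0).le, inv_mul_cancel₀ h0.ne']
      · simp [q, smul_smul, mul_inv_cancel₀ h0.ne']
  have hq : IsQuotientMap q := .of_surjective_continuous hqsurj q.continuous
  have hfac : Function.FactorsThrough h.toContinuousMap q := by
    rintro ⟨s, b⟩ ⟨s', b'⟩ hz
    have hv : c + (1 - s : ℝ) • ((b : V) - c) = c + (1 - s' : ℝ) • ((b' : V) - c) :=
      congrArg Subtype.val hz
    obtain rfl : s = s' := by
      have := congrArg ρ hv
      rw [hρq (s, b), hρq (s', b')] at this
      exact Subtype.ext (by linarith)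
    by_cases hs : s = 1
    · subst hs
      exact (h.apply_one b).trans (h.apply_one b').symm
    · have hs' : (1 - s : ℝ) ≠ 0 := fun h' => hs (Subtype.ext (sub_eq_zero.1 h').symm)
      rw [add_right_inj, smul_right_inj hs', sub_left_inj] at hv
      rw [Subtype.ext hv]
  let G := hq.lift h.toContinuousMap hfac
  have hG : ∀ z, G (q z) = h z := fun z => congrArg (fun k => k z) (hq.lift_comp _ hfac)
  refine ⟨fun x => if hx : x ∈ D then G ⟨x, hx⟩ else y, ?_, fun x hx => ?_⟩
  · rw [continuousOn_iff_continuous_domRestrict]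
    convert G.continuous using 1
    funext x
    exact dif_pos x.2
  · have hxD : x ∈ D := (hD x).2 ⟨((hB x).1 hx).1, ((hB x).1 hx).2.le⟩
    have hxq : (⟨x, hxD⟩ : D) = q (0, ⟨x, hx⟩) := Subtype.ext (by simp [q])
    exact (dif_pos hxD).trans ((congrArg G hxq).trans ((hG _).trans (h.apply_zero _)))

/-- The points of the simplex spanned by a finite set `σ` of vertices, in barycentric
coordinates. -/
def simplexOn {ι : Type*} (σ : Finset ι) : Set (ι → ℝ) :=
  {t | (∀ i, 0 ≤ t i) ∧ (∀ i ∉ σ, t i = 0) ∧ ∑ i ∈ σ, t i = 1}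

variable {ι : Type*}

theorem isClosed_simplexOn (σ : Finset ι) : IsClosed (simplexOn σ) := by
  have h1 : IsClosed {t : ι → ℝ | ∀ i, 0 ≤ t i} := by
    rw [Set.ofPred_forall]
    exact isClosed_iInter fun i => isClosed_le continuous_const (continuous_apply i)
  have h2 : IsClosed {t : ι → ℝ | ∀ i ∉ σ, t i = 0} := by
    simp only [Set.ofPred_forall]
    exact isClosed_iInter fun i => isClosed_iInter fun _ =>
      isClosed_eq (continuous_apply i) continuous_const
  exact h1.inter (h2.inter (isClosed_eq
    (continuous_finsetSum _ fun i _ => continuous_apply i) continuous_const))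

theorem le_one_of_mem_simplexOn {σ : Finset ι} {t : ι → ℝ} (ht : t ∈ simplexOn σ) (i : ι) :
    t i ≤ 1 := by
  by_cases hi : i ∈ σ
  · rw [← ht.2.2]
    exact Finset.single_le_sum (fun j _ => ht.1 j) hi
  · rw [ht.2.1 i hi]; exact zero_le_one

theorem isCompact_simplexOn (σ : Finset ι) : IsCompact (simplexOn σ) :=
  (isCompact_univ_pi fun _ => isCompact_Icc (a := (0 : ℝ)) (b := 1)).of_isClosed_subset
    (isClosed_simplexOn σ) fun _ ht i _ => ⟨ht.1 i, le_one_of_mem_simplexOn ht i⟩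

theorem nonempty_of_mem_simplexOn {σ : Finset ι} {t : ι → ℝ} (ht : t ∈ simplexOn σ) :
    σ.Nonempty := by
  rw [Finset.nonempty_iff_ne_empty]
  rintro rfl
  simpa using ht.2.2

theorem support_subset_of_mem_simplexOn {σ : Finset ι} {t : ι → ℝ} (ht : t ∈ simplexOn σ) :
    Function.support t ⊆ σ := fun i hi => by
  by_contra hi'
  exact hi (ht.2.1 i hi')

theorem mem_simplexOn_erase [DecidableEq ι] {σ : Finset ι} {t : ι → ℝ} (ht : t ∈ simplexOn σ)
    {i : ι} (hi : t i = 0) : t ∈ simplexOn (σ.erase i) :=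
  ⟨ht.1, fun j hj => by
    by_cases h : j = i
    · rw [h, hi]
    · exact ht.2.1 j fun h' => hj (Finset.mem_erase.2 ⟨h, h'⟩), by
    rw [Finset.sum_erase _ hi, ht.2.2]⟩

/-- The boundary of the prism `simplexOn σ ×ˢ Set.Icc 0 1`. -/
def prismBoundary (σ : Finset ι) : Set ((ι → ℝ) × ℝ) :=
  {x | x ∈ simplexOn σ ×ˢ Set.Icc (0 : ℝ) 1 ∧ ((∃ i ∈ σ, x.1 i = 0) ∨ x.2 = 0 ∨ x.2 = 1)}

theorem exists_continuousOn_prism {Y : Type*} [TopologicalSpace Y] {σ : Finset ι}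
    (hσ : σ.Nonempty) (hnull : ∀ B : Set ((ι → ℝ) × ℝ), IsCompact B → ∀ g : C(B, Y),
      g.Nullhomotopic) {f : (ι → ℝ) × ℝ → Y} (hf : ContinuousOn f (prismBoundary σ)) :
    ∃ G : (ι → ℝ) × ℝ → Y, ContinuousOn G (simplexOn σ ×ˢ Set.Icc (0 : ℝ) 1) ∧
      Set.EqOn G f (prismBoundary σ) := by
  classical
  let n : ℝ := σ.card
  have hn : 0 < n := Nat.cast_pos.2 hσ.card_pos
  let A : Set ((ι → ℝ) × ℝ) := {x | (∀ i ∉ σ, x.1 i = 0) ∧ ∑ i ∈ σ, x.1 i = 1}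
  let c : (ι → ℝ) × ℝ := (fun i => if i ∈ σ then n⁻¹ else 0, 1 / 2)
  let ρ : (ι → ℝ) × ℝ → ℝ := fun x => max (σ.sup' hσ fun i => 1 - n * x.1 i) |2 * x.2 - 1|
  have hc : ∑ i ∈ σ, c.1 i = 1 := by
    simp [c, n, mul_inv_cancel₀ hn.ne']
  have hcont : Continuous ρ := by
    refine Continuous.max (Continuous.finset_sup'_apply hσ fun i _ => ?_) ?_ <;> fun_prop
  have hle : ∀ x ∈ A, ρ x ≤ 1 ↔ x ∈ simplexOn σ ×ˢ Set.Icc (0 : ℝ) 1 := by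
    intro x hx
    simp only [ρ, max_le_iff, Finset.sup'_le_iff, abs_le]
    constructor
    · rintro ⟨h1, h2, h3⟩
      refine ⟨⟨fun i => ?_, hx⟩, by linarith, by linarith⟩
      by_cases hi : i ∈ σ
      · have := h1 i hi
        exact nonneg_of_mul_nonneg_right (by linarith) hn
      · exact (hx.1 i hi).ge
    · rintro ⟨h1, h2, h3⟩
      exact ⟨fun i _ => by linarith [mul_nonneg hn.le (h1.1 i)], by linarith, by linarith⟩
  have heq : ∀ x, (x ∈ A ∧ ρ x = 1) ↔ x ∈ prismBoundary σ := by
    intro x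
    constructor
    · rintro ⟨hx, h⟩
      refine ⟨(hle x hx).1 h.le, ?_⟩
      by_contra! hcon
      have hmem := (hle x hx).1 h.le
      refine h.not_lt (max_lt ((Finset.sup'_lt_iff _).2 fun i hi => ?_) (abs_lt.2 ⟨?_, ?_⟩))
      · have := mul_pos hn ((hmem.1.1 i).lt_of_ne (hcon.1 i hi).symm)
        linarith
      · have := hmem.2.1.lt_of_ne hcon.2.1.symm
        linarith
      · have := hmem.2.2.lt_of_ne hcon.2.2
        linarith
    · rintro ⟨hx, h⟩
      refine ⟨hx.1.2, le_antisymm ((hle x hx.1.2).2 hx) ?_⟩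
      rcases h with ⟨i, hi, h⟩ | h | h
      · refine le_max_of_le_left (Finset.le_sup'_of_le _ hi ?_)
        simp [h]
      · exact le_max_of_le_right (by simp [h])
      · exact le_max_of_le_right (by norm_num [h])
  have hprism : ∀ x, x ∈ simplexOn σ ×ˢ Set.Icc (0 : ℝ) 1 ↔ x ∈ A ∧ ρ x ≤ 1 :=
    fun x => ⟨fun h => ⟨h.1.2, (hle x h.1.2).2 h⟩, fun h => (hle x h.1).1 h.2⟩
  have hcomp : IsCompact (prismBoundary σ) := by
    have h : prismBoundary σ = (simplexOn σ ×ˢ Set.Icc (0 : ℝ) 1) ∩ ρ ⁻¹' {1} :=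
      Set.ext fun x => ⟨fun h => ⟨h.1, ((heq x).2 h).2⟩, fun h => (heq x).1 ⟨h.1.1.2, h.2⟩⟩
    rw [h]
    exact ((isCompact_simplexOn σ).prod isCompact_Icc).inter_right
      (isClosed_singleton.preimage hcont)
  have := isCompact_iff_compactSpace.1 hcomp
  refine exists_continuousOn_eqOn_of_nullhomotopic (A := A) (c := c) (ρ := ρ) ?_ ?_ ?_
    (fun x => (heq x).symm) hprism ?_ (hnull _ hcomp) hf
  · intro x hx a
    refine ⟨fun i hi => ?_, ?_⟩
    · simp [c, hx.1 i hi, hi]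
    · change ∑ i ∈ σ, (c.1 i + a * (x.1 i - c.1 i)) = 1
      rw [Finset.sum_add_distrib, ← Finset.mul_sum, Finset.sum_sub_distrib, hc, hx.2]
      ring
  · intro x a ha
    simp only [ρ]
    rw [mul_max_of_nonneg _ _ ha, Finset.mul₀_sup' ha, ← abs_of_nonneg ha, ← abs_mul,
      abs_of_nonneg ha]
    congr 1
    · refine Finset.sup'_congr hσ rfl fun i hi => ?_
      simp only [c, Prod.fst_add, Prod.smul_fst, Prod.fst_sub, Pi.add_apply, Pi.smul_apply,
        Pi.sub_apply, if_pos hi, smul_eq_mul]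
      field_simp
      ring
    · congr 1
      simp only [c, Prod.snd_add, Prod.smul_snd, Prod.snd_sub, smul_eq_mul]
      ring
  · intro x hx h
    obtain ⟨h1, h2⟩ := max_le_iff.1 h
    rw [Finset.sup'_le_iff] at h1
    have hi : ∀ i ∈ σ, c.1 i ≤ x.1 i := fun i hi => by
      have := h1 i hi
      simp only [c, if_pos hi]
      rw [inv_le_iff_one_le_mul₀' hn]
      linarith
    refine Prod.ext (funext fun i => ?_) ?_
    · by_cases h : i ∈ σ
      · exact ((Finset.sum_eq_sum_iff_of_le hi).1 (hc.trans hx.2.symm) i h).symm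
      · rw [hx.1 i h]; simp [c, h]
    · have := abs_nonpos_iff.1 h2
      simp only [c]
      linarith
  · refine ⟨(c.1, 0), ⟨⟨fun i => ?_, fun i hi => by simp [c, hi], hc⟩, by simp⟩, by simp⟩
    simp only [c]
    split_ifs <;> positivity

end Extension

section SimplicialContraction

variable {ι Y : Type*} [TopologicalSpace Y]

theorem exists_coe_eq_support_of_mem_simplexOn {σ : Finset ι} {t : ι → ℝ}
    (ht : t ∈ simplexOn σ) :
    ∃ τ ⊆ σ, (τ : Set ι) = Function.support t ∧ t ∈ simplexOn τ := by
  classical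
  refine ⟨σ.filter fun i => t i ≠ 0, Finset.filter_subset _ _, ?_, ht.1, fun i hi => ?_, ?_⟩
  · ext i
    simpa using fun h => support_subset_of_mem_simplexOn ht h
  · by_contra h
    exact hi (Finset.mem_filter.2 ⟨support_subset_of_mem_simplexOn ht h, h⟩)
  · rw [Finset.sum_filter_ne_zero, ht.2.2]

/-- `F` is a homotopy from `b` to the constant map `y` on the geometric realization of the
simplicial complex `K`, whose continuity is only asserted on the simplices with at most `n`
vertices. -/
def IsSkeletalContraction (K : Set (Finset ι)) (b : (ι → ℝ) → Y) (y : Y) (n : ℕ)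
    (F : (ι → ℝ) × ℝ → Y) : Prop :=
  (∀ σ ∈ K, ∀ t ∈ simplexOn σ, F (t, 0) = b t ∧ F (t, 1) = y) ∧
    ∀ σ ∈ K, σ.card ≤ n → ContinuousOn F (simplexOn σ ×ˢ Set.Icc (0 : ℝ) 1)

variable {K : Set (Finset ι)} {b : (ι → ℝ) → Y} {y : Y}

theorem IsSkeletalContraction.continuousOn_prismBoundary {n : ℕ} {F : (ι → ℝ) × ℝ → Y}
    (hF : IsSkeletalContraction K b y n F) (hK : ∀ σ ∈ K, ∀ τ ⊆ σ, τ ∈ K)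
    (hb : ∀ σ ∈ K, ContinuousOn b (simplexOn σ)) {σ : Finset ι} (hσ : σ ∈ K)
    (hn : σ.card = n + 1) : ContinuousOn F (prismBoundary σ) := by
  classical
  have h₁ : ContinuousOn F (⋃ i : σ, simplexOn (σ.erase i) ×ˢ Set.Icc (0 : ℝ) 1) :=
    (locallyFinite_of_finite _).continuousOn_iUnion
      (fun i => (isClosed_simplexOn _).prod isClosed_Icc) fun i =>
        hF.2 _ (hK σ hσ _ (Finset.erase_subset _ _))
          (by rw [Finset.card_erase_of_mem i.2, hn]; simp)
  have h₂ : ContinuousOn F (simplexOn σ ×ˢ {0}) :=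
    ((hb σ hσ).comp continuousOn_fst fun x hx => hx.1).congr fun x hx => by
      obtain ⟨t, s⟩ := x
      obtain ⟨ht, rfl : s = 0⟩ := hx
      exact (hF.1 σ hσ t ht).1
  have h₃ : ContinuousOn F (simplexOn σ ×ˢ {1}) :=
    (continuousOn_const (c := y)).congr fun x hx => by
      obtain ⟨t, s⟩ := x
      obtain ⟨ht, rfl : s = 1⟩ := hx
      exact (hF.1 σ hσ t ht).2
  have hcl₁ : IsClosed (⋃ i : σ, simplexOn (σ.erase i) ×ˢ Set.Icc (0 : ℝ) 1) :=
    isClosed_iUnion_of_finite fun i => (isClosed_simplexOn _).prod isClosed_Icc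
  have hcl : ∀ a : ℝ, IsClosed (simplexOn σ ×ˢ {a}) := fun a =>
    (isClosed_simplexOn σ).prod isClosed_singleton
  refine ((h₁.union_of_isClosed h₂ hcl₁ (hcl 0)).union_of_isClosed h₃
    (hcl₁.union (hcl 0)) (hcl 1)).mono ?_
  rintro x ⟨hx, ⟨i, hi, h⟩ | h | h⟩
  · exact Or.inl (Or.inl (Set.mem_iUnion.2 ⟨⟨i, hi⟩, mem_simplexOn_erase hx.1 h, hx.2⟩))
  · exact Or.inl (Or.inr ⟨hx.1, h⟩)
  · exact Or.inr ⟨hx.1, h⟩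

theorem IsSkeletalContraction.exists_succ {n : ℕ} {F : (ι → ℝ) × ℝ → Y}
    (hF : IsSkeletalContraction K b y n F) (hK : ∀ σ ∈ K, ∀ τ ⊆ σ, τ ∈ K)
    (hb : ∀ σ ∈ K, ContinuousOn b (simplexOn σ))
    (hnull : ∀ B : Set ((ι → ℝ) × ℝ), IsCompact B → ∀ g : C(B, Y), g.Nullhomotopic) :
    ∃ F' : (ι → ℝ) × ℝ → Y, IsSkeletalContraction K b y (n + 1) F' ∧
      ∀ x : (ι → ℝ) × ℝ, (Function.support x.1).ncard ≤ n → F' x = F x := by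
  classical
  have hG : ∀ S : Set ι, ∃ G : (ι → ℝ) × ℝ → Y, ∀ σ : Finset ι, ↑σ = S → σ ∈ K →
      σ.card = n + 1 → ContinuousOn G (simplexOn σ ×ˢ Set.Icc (0 : ℝ) 1) ∧
        Set.EqOn G F (prismBoundary σ) := fun S => by
    by_cases hS : ∃ σ : Finset ι, ↑σ = S ∧ σ ∈ K ∧ σ.card = n + 1
    · obtain ⟨σ, rfl, hσ, hn⟩ := hS
      obtain ⟨G, hG⟩ := exists_continuousOn_prism (Finset.card_pos.1 (by omega)) hnull
        (hF.continuousOn_prismBoundary hK hb hσ hn)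
      refine ⟨G, fun τ hτ _ _ => ?_⟩
      rwa [Finset.coe_injective hτ]
    · exact ⟨F, fun σ h₁ h₂ h₃ => absurd ⟨σ, h₁, h₂, h₃⟩ hS⟩
  choose G hG using hG
  let F' : (ι → ℝ) × ℝ → Y := fun x =>
    if (Function.support x.1).ncard = n + 1 then G (Function.support x.1) x else F x
  have hlow : ∀ x : (ι → ℝ) × ℝ, (Function.support x.1).ncard ≠ n + 1 → F' x = F x :=
    fun x hx => if_neg hx
  have hhigh : ∀ τ ∈ K, τ.card = n + 1 → ∀ x : (ι → ℝ) × ℝ, (τ : Set ι) = Function.support x.1 →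
      F' x = G τ x := fun τ _ hn x hx => by
    simp only [F', ← hx, Set.ncard_coe_finset, hn, if_true]
  have hbd : ∀ σ ∈ K, ∀ t ∈ simplexOn σ, ∀ s : ℝ, s = 0 ∨ s = 1 → F' (t, s) = F (t, s) := by
    intro σ hσ t ht s hs
    by_cases hn : (Function.support t).ncard = n + 1
    · obtain ⟨τ, hτσ, hτ, htτ⟩ := exists_coe_eq_support_of_mem_simplexOn ht
      have hτn : τ.card = n + 1 := by rw [← Set.ncard_coe_finset, hτ, hn]
      have hτK := hK σ hσ τ hτσ
      rw [hhigh τ hτK hτn _ hτ]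
      refine (hG τ τ rfl hτK hτn).2 ⟨⟨htτ, ?_⟩, Or.inr hs⟩
      rcases hs with rfl | rfl <;> simp
    · exact hlow _ hn
  refine ⟨F', ⟨fun σ hσ t ht => ?_, fun σ hσ hn => ?_⟩, fun x hx => hlow x (by omega)⟩
  · rw [hbd σ hσ t ht 0 (Or.inl rfl), hbd σ hσ t ht 1 (Or.inr rfl)]
    exact hF.1 σ hσ t ht
  · rcases hn.lt_or_eq with hn | hn
    · refine (hF.2 σ hσ (by omega)).congr fun x hx => hlow x fun h => ?_
      have := Set.ncard_le_ncard (support_subset_of_mem_simplexOn hx.1) σ.finite_toSet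
      rw [h, Set.ncard_coe_finset] at this
      omega
    · refine (hG σ σ rfl hσ hn).1.congr fun x hx => ?_
      by_cases hs : (σ : Set ι) = Function.support x.1
      · exact hhigh σ hσ hn x hs
      · have hsub := support_subset_of_mem_simplexOn hx.1
        obtain ⟨i, hi, hi'⟩ := Set.exists_of_ssubset (hsub.ssubset_of_ne fun h => hs h.symm)
        have hlt := Set.ncard_lt_ncard (hsub.ssubset_of_ne fun h => hs h.symm) σ.finite_toSet
        rw [Set.ncard_coe_finset, hn] at hlt
        rw [hlow x hlt.ne]
        exact ((hG σ σ rfl hσ hn).2 ⟨hx, Or.inl ⟨i, hi, Function.notMem_support.1 hi'⟩⟩).symm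

/-- A map from a simplicial complex to a space in which all compact families are nullhomotopic is
nullhomotopic. -/
theorem exists_simplicial_contraction (hK : ∀ σ ∈ K, ∀ τ ⊆ σ, τ ∈ K)
    (hb : ∀ σ ∈ K, ContinuousOn b (simplexOn σ)) (y : Y)
    (hnull : ∀ B : Set ((ι → ℝ) × ℝ), IsCompact B → ∀ g : C(B, Y), g.Nullhomotopic) :
    ∃ F : (ι → ℝ) × ℝ → Y,
      (∀ σ ∈ K, ContinuousOn F (simplexOn σ ×ˢ Set.Icc (0 : ℝ) 1)) ∧
      ∀ σ ∈ K, ∀ t ∈ simplexOn σ, F (t, 0) = b t ∧ F (t, 1) = y := by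
  classical
  have h0 : IsSkeletalContraction K b y 0 fun x => if x.2 = 0 then b x.1 else y := by
    refine ⟨fun σ _ t _ => by simp, fun σ _ hn => ?_⟩
    have hempty : simplexOn σ = ∅ := by
      by_contra h
      obtain ⟨t, ht⟩ := Set.nonempty_iff_ne_empty.2 h
      exact (nonempty_of_mem_simplexOn ht).card_pos.not_ge hn
    simp [hempty]
  choose! next hnext hnext' using
    fun (n : ℕ) (F : (ι → ℝ) × ℝ → Y) (hF : IsSkeletalContraction K b y n F) =>
      hF.exists_succ hK hb hnull
  let F : ℕ → (ι → ℝ) × ℝ → Y :=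
    fun n => n.rec (fun x => if x.2 = 0 then b x.1 else y) fun n F => next n F
  have hF : ∀ n, IsSkeletalContraction K b y n (F n) := fun n => by
    induction n with
    | zero => exact h0
    | succ n ih => exact hnext n _ ih
  have hstable : ∀ k n, k ≤ n → ∀ x : (ι → ℝ) × ℝ, (Function.support x.1).ncard ≤ k →
      F n x = F k x := fun k n hkn x hx => by
    induction n, hkn using Nat.le_induction with
    | base => rfl
    | succ n hkn ih => exact (hnext' n _ (hF n) x (hx.trans hkn)).trans ih
  refine ⟨fun x => F (Function.support x.1).ncard x, fun σ hσ => ?_,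
    fun σ hσ t ht => (hF _).1 σ hσ t ht⟩
  refine ((hF σ.card).2 σ hσ le_rfl).congr fun x hx => (hstable _ _ ?_ x le_rfl).symm
  rw [← Set.ncard_coe_finset]
  exact Set.ncard_le_ncard (support_subset_of_mem_simplexOn hx.1) σ.finite_toSet

end SimplicialContraction

section Retract

open ContinuousMap

/-- A uniform neighbourhood retract of a normed space in which all compact families are
nullhomotopic is contractible. -/
theorem contractibleSpace_of_retraction {E : Type*} [NormedAddCommGroup E] [NormedSpace ℝ E]
    {p : E → Prop} [Nonempty (Subtype p)] {r : E → Subtype p} (hr : ∀ x : Subtype p, r x = x)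
    {U : Set E} (hrU : ContinuousOn r U) {δ : ℝ} (hδ : 0 < δ)
    (hU : ∀ x : Subtype p, Metric.ball (x : E) δ ⊆ U)
    (hnull : ∀ B : Set ((Subtype p → ℝ) × ℝ), IsCompact B → ∀ g : C(B, Subtype p),
      g.Nullhomotopic) : ContractibleSpace (Subtype p) := by
  classical
  rw [contractible_iff_id_nullhomotopic]
  obtain ⟨φ, hφ⟩ := PartitionOfUnity.exists_isSubordinate (X := Subtype p) isClosed_univ
    (fun i : Subtype p => Metric.ball i δ) (fun _ => Metric.isOpen_ball)
    fun x _ => Set.mem_iUnion.2 ⟨x, Metric.mem_ball_self hδ⟩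
  let m : Subtype p → E := fun x => ∑ᶠ i, φ i x • (i : E)
  have hm : Continuous m := φ.continuous_finsum_smul fun i x _ => continuousAt_const
  have hmball : ∀ x : Subtype p, m x ∈ Metric.ball (x : E) δ := fun x =>
    (convex_ball (x : E) δ).finsum_mem (fun i => φ.nonneg i x) (φ.sum_eq_one (Set.mem_univ x))
      fun i hi => by
        have : x ∈ Metric.ball i δ := hφ i (subset_tsupport _ hi)
        rwa [Metric.mem_ball, dist_comm] at this
  let K : Set (Finset (Subtype p)) :=
    {σ | ∃ x : Subtype p, ∀ i ∈ σ, (i : E) ∈ Metric.ball (x : E) δ}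
  let b : (Subtype p → ℝ) → Subtype p := fun t => r (∑ᶠ i, t i • (i : E))
  have hb : ∀ σ ∈ K, ContinuousOn b (simplexOn σ) := by
    rintro σ ⟨x, hx⟩
    have h : ContinuousOn (fun t : Subtype p → ℝ => r (∑ i ∈ σ, t i • (i : E))) (simplexOn σ) := by
      refine hrU.comp (Continuous.continuousOn (by fun_prop)) fun t ht => hU x ?_
      exact (convex_ball (x : E) δ).sum_mem (fun i _ => ht.1 i) ht.2.2 hx
    refine h.congr fun t ht => ?_
    simp only [b]
    rw [finsum_eq_sum_of_support_subset]
    exact (Function.support_smul_subset_left _ _).trans (support_subset_of_mem_simplexOn ht)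
  obtain ⟨y⟩ := ‹Nonempty (Subtype p)›
  obtain ⟨F, hFc, hF⟩ := exists_simplicial_contraction (K := K)
    (fun σ ⟨x, hx⟩ τ hτ => ⟨x, fun i hi => hx i (hτ hi)⟩) hb y hnull
  have hφK : ∀ x, φ.fintsupport x ∈ K := fun x => ⟨x, fun i hi => by
    have : x ∈ Metric.ball i δ := hφ i ((φ.mem_fintsupport_iff x i).1 hi)
    rwa [Metric.mem_ball, dist_comm] at this⟩
  have hφmem : ∀ x x', φ.finsupport x ⊆ φ.fintsupport x' →
      (fun i => φ i x) ∈ simplexOn (φ.fintsupport x') := fun x x' h =>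
    ⟨fun i => φ.nonneg i x, fun i hi => by
      by_contra hi'
      exact hi (h ((φ.mem_finsupport x).2 hi')), φ.sum_finsupport' (Set.mem_univ x) h⟩
  have hφself : ∀ x, (fun i => φ i x) ∈ simplexOn (φ.fintsupport x) := fun x =>
    hφmem x x (φ.finsupport_subset_fintsupport x)
  let f : C(Subtype p, Subtype p) :=
    ⟨fun x => r (m x), hrU.comp_continuous hm fun x => hU x (hmball x)⟩
  refine ⟨y, Homotopic.trans (g := f) ⟨⟨⟨fun z => r ((1 - z.1 : ℝ) • (z.2 : E) + (z.1 : ℝ) • m z.2),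
    ?_⟩, fun x => ?_, fun x => ?_⟩⟩ ⟨⟨⟨fun z => F (fun i => φ i z.2, z.1), ?_⟩,
    fun x => ?_, fun x => ?_⟩⟩⟩
  · refine hrU.comp_continuous (by fun_prop) fun z => hU z.2 ?_
    exact convex_ball (z.2 : E) δ (Metric.mem_ball_self hδ) (hmball z.2)
      (sub_nonneg.2 z.1.2.2) z.1.2.1 (by ring)
  · simp [hr]
  · simp [f]
  · rw [continuous_iff_continuousAt]
    rintro ⟨s, x⟩
    have hc : Continuous fun z : unitInterval × Subtype p =>
        ((fun i => φ i z.2, (z.1 : ℝ)) : (Subtype p → ℝ) × ℝ) := by fun_prop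
    refine Tendsto.comp (hFc _ (hφK x) _ ⟨hφself x, s.2⟩)
      (tendsto_nhdsWithin_iff.2 ⟨hc.continuousAt, ?_⟩)
    filter_upwards [continuous_snd.continuousAt.eventually (φ.eventually_finsupport_subset x)]
      with z hz
    exact ⟨hφmem _ _ hz, z.1.2⟩
  · exact (hF _ (hφK x) _ (hφself x)).1
  · exact (hF _ (hφK x) _ (hφself x)).2

end Retract

theorem OrthComplexStructure.ball_subset {A : Type*} [NormedRing A] [StarRing A] [CStarRing A]
    [NormedAlgebra ℝ A] [StarModule ℝ A] (J : OrthComplexStructure A) :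
    Metric.ball (J : A) (1 / 3) ⊆ {a | ‖1 + skewPart a * skewPart a‖ < 1} := by
  intro a ha
  rw [mem_ball_iff_norm] at ha
  obtain ⟨d, hd⟩ : ∃ d, d = skewPart a - J := ⟨_, rfl⟩
  have hd_eq : d = (1 / 2 : ℝ) • ((a - J) - star (a - J)) := by
    rw [hd, skewPart, star_sub, J.2.1]
    module
  have hd_norm : ‖d‖ < 1 / 3 := by
    have h := norm_sub_le (a - (J : A)) (star (a - J))
    rw [norm_star] at h
    rw [hd_eq, norm_smul, Real.norm_of_nonneg (by norm_num)]
    linarith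
  have hexpand : 1 + skewPart a * skewPart a = J * d + d * J + d * d := by
    rw [eq_add_of_sub_eq hd.symm, add_mul, mul_add, mul_add, J.2.2]
    abel
  have hJ := J.norm_le_one
  have h₁ : ‖(J : A) * d‖ ≤ ‖d‖ :=
    (norm_mul_le _ _).trans (mul_le_of_le_one_left (norm_nonneg _) hJ)
  have h₂ : ‖d * (J : A)‖ ≤ ‖d‖ :=
    (norm_mul_le _ _).trans (mul_le_of_le_one_right (norm_nonneg _) hJ)
  have h₃ : ‖d * d‖ ≤ ‖d‖ :=
    (norm_mul_le _ _).trans (mul_le_of_le_one_left (norm_nonneg _) (by linarith))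
  rw [Set.mem_ofPred_eq, hexpand]
  linarith [norm_add₃_le (a := (J : A) * d) (b := d * J) (c := d * d)]

/-- For a separable infinite-dimensional real Hilbert space `H`, the space
`J(H)` of orthogonal complex structures (bounded operators `J` with `J* = -J` and
`J² = -1`), with the operator-norm topology, is contractible. -/
theorem stmt11 {H : Type*} [NormedAddCommGroup H] [InnerProductSpace ℝ H] [CompleteSpace H]
    [TopologicalSpace.SeparableSpace H] (hinf : ¬FiniteDimensional ℝ H) :
    ContractibleSpace
      {J : H →L[ℝ] H // ContinuousLinearMap.adjoint J = -J ∧ J * J = -1} := by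
  change ContractibleSpace (OrthComplexStructure (H →L[ℝ] H))
  obtain ⟨J₀, -⟩ := nullhomotopic_of_compactSpace hinf
    (⟨Empty.elim, continuous_of_discreteTopology⟩ :
      C(Empty, OrthComplexStructure (H →L[ℝ] H)))
  have : Nonempty (OrthComplexStructure (H →L[ℝ] H)) := ⟨J₀⟩
  exact contractibleSpace_of_retraction (polarRetraction_coe J₀) (continuousOn_polarRetraction J₀)
    (by norm_num : (0 : ℝ) < 1 / 3) OrthComplexStructure.ball_subset fun B hB g =>
      have := isCompact_iff_compactSpace.1 hB
      nullhomotopic_of_compactSpace hinf g
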